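/- arXiv:2311.00963 — 5 statements merged into one kernel-verified Lean document; each statement's English description precedes it below -/
import Mathlib

section
/- For every complex number a with a² ≠ 4, the T_{2,4,4} singularity f(x,y) = a x² y² + x⁴ + y⁴ satisfies lct₀(f) = 1/2. -/
open MeasureTheory

/-- The log canonical threshold at the origin of a function `f : ℂ × ℂ → ℂ`,
defined via the complex singularity exponent. -/
noncomputable def lct₀ (f : ℂ × ℂ → ℂ) : ℝ :=
  sSup { c : ℝ | 0 ≤ c ∧ ∃ ε : ℝ, 0 < ε ∧
    IntegrableOn (fun p : ℂ × ℂ => ‖f p‖ ^ (-2 * c)) (Metric.ball (0 : ℂ × ℂ) ε) volume }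

/-- Subadditivity of `t ↦ t ^ p` turns a difference bounded away from zero into a bound for the
negative power of a product. -/
theorem norm_mul_rpow_neg_le {p : ℝ} (hp : 0 < p) (hp1 : p ≤ 1) {z w d : ℂ} (hd : d ≠ 0)
    (hzw : z - w = d) :
    ‖z * w‖ ^ (-p) ≤ ‖d‖ ^ (-p) * (‖z‖ ^ (-p) + ‖w‖ ^ (-p)) := by
  have hR : 0 ≤ ‖d‖ ^ (-p) * (‖z‖ ^ (-p) + ‖w‖ ^ (-p)) := by positivity
  rcases eq_or_ne z 0 with rfl | hz
  · simpa [Real.zero_rpow (neg_ne_zero.2 hp.ne')] using hR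
  rcases eq_or_ne w 0 with rfl | hw
  · simpa [Real.zero_rpow (neg_ne_zero.2 hp.ne')] using hR
  have hz' : 0 < ‖z‖ ^ p := Real.rpow_pos_of_pos (norm_pos_iff.2 hz) p
  have hw' : 0 < ‖w‖ ^ p := Real.rpow_pos_of_pos (norm_pos_iff.2 hw) p
  have hd' : 0 < ‖d‖ ^ p := Real.rpow_pos_of_pos (norm_pos_iff.2 hd) p
  have key : ‖d‖ ^ p ≤ ‖z‖ ^ p + ‖w‖ ^ p :=
    (Real.rpow_le_rpow (norm_nonneg _) (hzw ▸ norm_sub_le z w) hp.le).trans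
      (Real.rpow_add_le_add_rpow (norm_nonneg _) (norm_nonneg _) hp.le hp1)
  rw [norm_mul, Real.mul_rpow (norm_nonneg _) (norm_nonneg _), Real.rpow_neg (norm_nonneg _),
    Real.rpow_neg (norm_nonneg _), Real.rpow_neg (norm_nonneg _)]
  have e : (‖d‖ ^ p)⁻¹ * ((‖z‖ ^ p)⁻¹ + (‖w‖ ^ p)⁻¹) =
      (‖z‖ ^ p)⁻¹ * (‖w‖ ^ p)⁻¹ * ((‖z‖ ^ p + ‖w‖ ^ p) / ‖d‖ ^ p) := by
    field_simp
    ring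
  rw [e]
  exact le_mul_of_one_le_right (by positivity) ((one_le_div hd').2 key)

theorem integrableOn_norm_sub_rpow_neg {p : ℝ} (hp1 : p < 2) (r : ℂ) (R : ℝ) :
    IntegrableOn (fun u : ℂ => ‖u - r‖ ^ (-p)) (Metric.ball 0 R) := by
  have h : IntegrableOn (fun u : ℂ => ‖u‖ ^ (-p)) (Metric.ball 0 (R + ‖r‖)) := by
    refine integrableOn_ball_of_norm_le_rpow (by simp) (C := 1) (α := p) (by simpa using hp1)
      (Filter.Eventually.of_forall fun u => ?_)
      (Measurable.aestronglyMeasurable (by fun_prop))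
    rw [one_mul, Real.norm_of_nonneg (by positivity)]
  have h' := ((integrable_indicator_iff Metric.isOpen_ball.measurableSet).2 h).comp_sub_right r
  refine h'.integrableOn.congr_fun (fun u hu => ?_) Metric.isOpen_ball.measurableSet
  refine Set.indicator_of_mem ?_ _
  rw [mem_ball_zero_iff] at hu ⊢
  exact (norm_sub_le u r).trans_lt (by gcongr)

theorem integrableOn_norm_sq_sub_sq_rpow_neg {p : ℝ} (hp : 0 < p) (hp1 : p ≤ 1) {σ : ℂ}
    (hσ : σ ≠ 0) (R : ℝ) :
    IntegrableOn (fun u : ℂ => ‖u ^ 2 - σ ^ 2‖ ^ (-p)) (Metric.ball 0 R) := by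
  refine Integrable.mono' (((integrableOn_norm_sub_rpow_neg (p := p) (by linarith) (-σ) R).add
    (integrableOn_norm_sub_rpow_neg (p := p) (by linarith) σ R)).const_mul (‖2 * σ‖ ^ (-p)))
    (Measurable.aestronglyMeasurable (by fun_prop)) (Filter.Eventually.of_forall fun u => ?_)
  rw [Real.norm_of_nonneg (by positivity), show u ^ 2 - σ ^ 2 = (u - -σ) * (u - σ) by ring]
  exact norm_mul_rpow_neg_le hp hp1 (mul_ne_zero two_ne_zero hσ) (by ring)

theorem integrableOn_norm_biquadratic_rpow_neg {p : ℝ} (hp : 0 < p) (hp1 : p ≤ 1) {a : ℂ}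
    (ha : a ^ 2 ≠ 4) (R : ℝ) :
    IntegrableOn (fun u : ℂ => ‖u ^ 4 + a * u ^ 2 + 1‖ ^ (-p)) (Metric.ball 0 R) := by
  obtain ⟨d, hd⟩ := IsAlgClosed.exists_pow_nat_eq (a ^ 2 - 4) two_pos
  obtain ⟨σ, hσ⟩ := IsAlgClosed.exists_pow_nat_eq ((-a + d) / 2) two_pos
  obtain ⟨τ, hτ⟩ := IsAlgClosed.exists_pow_nat_eq ((-a - d) / 2) two_pos
  have hd0 : d ≠ 0 := by
    rintro rfl
    exact ha (by linear_combination -hd)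
  have hst : σ ^ 2 * τ ^ 2 = 1 := by
    rw [hσ, hτ]
    linear_combination -hd / 4
  have hσ0 : σ ≠ 0 := by
    rintro rfl
    simp at hst
  have hτ0 : τ ≠ 0 := by
    rintro rfl
    simp at hst
  refine Integrable.mono' (((integrableOn_norm_sq_sub_sq_rpow_neg hp hp1 hτ0 R).add
    (integrableOn_norm_sq_sub_sq_rpow_neg hp hp1 hσ0 R)).const_mul (‖d‖ ^ (-p)))
    (Measurable.aestronglyMeasurable (by fun_prop)) (Filter.Eventually.of_forall fun u => ?_)
  rw [Real.norm_of_nonneg (by positivity), show u ^ 4 + a * u ^ 2 + 1 =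
    (u ^ 2 - τ ^ 2) * (u ^ 2 - σ ^ 2) by linear_combination -hst + u ^ 2 * (hσ + hτ)]
  exact norm_mul_rpow_neg_le hp hp1 hd0 (by linear_combination hσ - hτ)

theorem one_add_norm_pow_four_le (a u : ℂ) (hu : 2 + ‖a‖ ≤ ‖u‖) :
    (1 + ‖u‖) ^ 4 / 32 ≤ ‖u ^ 4 + a * u ^ 2 + 1‖ := by
  have h1 : ‖u‖ ^ 4 ≤ ‖u ^ 4 + a * u ^ 2 + 1‖ + ‖a‖ * ‖u‖ ^ 2 + 1 := by
    have h := norm_sub_le (u ^ 4 + a * u ^ 2 + 1) (a * u ^ 2 + 1)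
    have h' := norm_add_le (a * u ^ 2) 1
    rw [show u ^ 4 + a * u ^ 2 + 1 - (a * u ^ 2 + 1) = u ^ 4 by ring, norm_pow] at h
    rw [norm_mul, norm_pow, norm_one] at h'
    linarith
  have ha := norm_nonneg a
  set n := ‖u‖
  have hn : 2 ≤ n := by linarith
  have h2 : (1 + n) ^ 4 ≤ (3 / 2 * n) ^ 4 := by gcongr; linarith
  have h3 : ‖a‖ * n ^ 2 ≤ (n - 2) * n ^ 2 := by gcongr; linarith
  have h4 : (1 + n) ^ 4 / 32 ≤ n ^ 4 - (n - 2) * n ^ 2 - 1 := by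
    have h5 : 0 ≤ n ^ 2 * (n - 2) := mul_nonneg (sq_nonneg n) (by linarith)
    nlinarith [sq_nonneg (n ^ 2 - 2 * n), sq_nonneg n]
  linarith

theorem integrable_norm_biquadratic_rpow_neg {p : ℝ} (hp : 1 / 2 < p) (hp1 : p ≤ 1) {a : ℂ}
    (ha : a ^ 2 ≠ 4) :
    Integrable (fun u : ℂ => ‖u ^ 4 + a * u ^ 2 + 1‖ ^ (-p)) := by
  rw [← integrableOn_univ, ← Set.union_compl_self (Metric.ball (0 : ℂ) (2 + ‖a‖))]
  refine (integrableOn_norm_biquadratic_rpow_neg (by linarith) hp1 ha _).union ?_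
  have h : Integrable (fun u : ℂ => (1 + ‖u‖) ^ (-(4 * p))) :=
    integrable_one_add_norm (by rw [Complex.finrank_real_complex]; push_cast; linarith)
  refine Integrable.mono' (h.const_mul ((1 / 32) ^ (-p))).integrableOn
    (Measurable.aestronglyMeasurable (by fun_prop)) ?_
  filter_upwards [ae_restrict_mem Metric.isOpen_ball.measurableSet.compl] with u hu
  have hu' : 2 + ‖a‖ ≤ ‖u‖ := by simpa using hu
  rw [Real.norm_of_nonneg (by positivity)]
  calc ‖u ^ 4 + a * u ^ 2 + 1‖ ^ (-p) ≤ ((1 + ‖u‖) ^ 4 / 32) ^ (-p) :=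
        Real.rpow_le_rpow_of_nonpos (by positivity) (one_add_norm_pow_four_le a u hu')
          (by linarith)
    _ = (1 / 32) ^ (-p) * (1 + ‖u‖) ^ (-(4 * p)) := by
        rw [div_eq_mul_one_div, mul_comm, Real.mul_rpow (by positivity) (by positivity),
          ← Real.rpow_natCast, ← Real.rpow_mul (by positivity)]
        congr 2
        push_cast
        ring

theorem map_mul_right_volume_complex {z : ℂ} (hz : z ≠ 0) :
    Measure.map (fun x : ℂ => x * z) volume = ENNReal.ofReal ((‖z‖ ^ 2)⁻¹) • volume := by
  have hdet : LinearMap.det (LinearMap.mulLeft ℝ z) = ‖z‖ ^ 2 := by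
    rw [← Complex.normSq_eq_norm_sq, ← Algebra.norm_complex_apply]
    rfl
  have h := Measure.map_linearMap_addHaar_eq_smul_addHaar (volume : Measure ℂ)
    (f := LinearMap.mulLeft ℝ z) (by rw [hdet]; simpa using hz)
  rw [hdet, abs_of_nonneg (by positivity)] at h
  rw [← h]
  congr 1
  ext x
  simp [mul_comm]

theorem integrable_comp_mul_right_complex {g : ℂ → ℝ} (hg : Integrable g) {z : ℂ} (hz : z ≠ 0) :
    Integrable (fun x => g (x * z)) := by
  refine (integrable_map_equiv (Homeomorph.mulRight₀ z hz).toMeasurableEquiv g).1 ?_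
  change Integrable g (Measure.map (fun x : ℂ => x * z) volume)
  rw [map_mul_right_volume_complex hz]
  exact hg.smul_measure ENNReal.ofReal_ne_top

theorem integral_comp_mul_right_complex (g : ℂ → ℝ) {z : ℂ} (hz : z ≠ 0) :
    ∫ x, g (x * z) = (‖z‖ ^ 2)⁻¹ * ∫ x, g x := by
  have h := integral_map_equiv (Homeomorph.mulRight₀ z hz).toMeasurableEquiv (μ := volume) g
  change ∫ y, g y ∂(Measure.map (fun x : ℂ => x * z) volume) = ∫ x, g (x * z) at h
  rw [← h, map_mul_right_volume_complex hz, integral_smul_measure,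
    ENNReal.toReal_ofReal (by positivity), smul_eq_mul]

theorem T244_eq_mul_biquadratic (a x : ℂ) {y : ℂ} (hy : y ≠ 0) :
    a * x ^ 2 * y ^ 2 + x ^ 4 + y ^ 4 =
      y ^ 4 * ((x * y⁻¹) ^ 4 + a * (x * y⁻¹) ^ 2 + 1) := by
  field_simp
  ring

theorem integrableOn_T244 {a : ℂ} (ha : a ^ 2 ≠ 4) {c : ℝ} (hc : 1 / 4 < c) (hc' : c < 1 / 2) :
    IntegrableOn (fun p : ℂ × ℂ => ‖a * p.1 ^ 2 * p.2 ^ 2 + p.1 ^ 4 + p.2 ^ 4‖ ^ (-2 * c))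
      (Metric.ball 0 1) := by
  have hG := integrable_norm_biquadratic_rpow_neg (p := 2 * c) (by linarith) (by linarith) ha
  set G : ℂ → ℝ := fun u => ‖u ^ 4 + a * u ^ 2 + 1‖ ^ (-(2 * c)) with hGdef
  have hfib (x y : ℂ) (hy : y ≠ 0) : ‖a * x ^ 2 * y ^ 2 + x ^ 4 + y ^ 4‖ ^ (-2 * c) =
      ‖y‖ ^ (-(8 * c)) * G (x * y⁻¹) := by
    rw [T244_eq_mul_biquadratic a x hy, norm_mul, norm_pow,
      Real.mul_rpow (by positivity) (by positivity), ← Real.rpow_natCast,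
      ← Real.rpow_mul (norm_nonneg _), hGdef]
    congr 2 <;> push_cast <;> ring
  suffices h : Integrable
      (fun p : ℂ × ℂ => ‖a * p.1 ^ 2 * p.2 ^ 2 + p.1 ^ 4 + p.2 ^ 4‖ ^ (-2 * c))
      (volume.prod (volume.restrict (Metric.ball 0 1))) by
    have h' : IntegrableOn
        (fun p : ℂ × ℂ => ‖a * p.1 ^ 2 * p.2 ^ 2 + p.1 ^ 4 + p.2 ^ 4‖ ^ (-2 * c))
        (Set.univ ×ˢ Metric.ball 0 1) := by
      rwa [IntegrableOn, Measure.volume_eq_prod, ← Measure.prod_restrict, Measure.restrict_univ]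
    refine h'.mono_set fun p hp => ⟨Set.mem_univ _, ?_⟩
    rw [mem_ball_zero_iff] at hp ⊢
    exact (norm_snd_le p).trans_lt hp
  have hne : ∀ᵐ y : ℂ ∂(volume.restrict (Metric.ball 0 1)), y ≠ 0 :=
    ae_restrict_of_ae (Measure.ae_ne volume 0)
  rw [integrable_prod_iff' (Measurable.aestronglyMeasurable (by fun_prop))]
  constructor
  · filter_upwards [hne] with y hy
    simp only [hfib _ y hy]
    exact (integrable_comp_mul_right_complex hG (inv_ne_zero hy)).const_mul _
  · have h : IntegrableOn (fun y : ℂ => ‖y - 0‖ ^ (-(8 * c - 2)) * ∫ u, G u)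
        (Metric.ball 0 1) :=
      (integrableOn_norm_sub_rpow_neg (by linarith) 0 1).mul_const _
    refine Integrable.congr h ?_
    filter_upwards [hne] with y hy
    simp only [hfib _ y hy]
    have hpos : 0 < ‖y‖ := norm_pos_iff.2 hy
    have hnn (x : ℂ) : ‖‖y‖ ^ (-(8 * c)) * G (x * y⁻¹)‖ = ‖y‖ ^ (-(8 * c)) * G (x * y⁻¹) :=
      Real.norm_of_nonneg (by positivity)
    simp only [hnn]
    rw [integral_const_mul, integral_comp_mul_right_complex G (inv_ne_zero hy), sub_zero,
      norm_inv, inv_pow, inv_inv, ← mul_assoc, ← Real.rpow_natCast, ← Real.rpow_add hpos]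
    congr 2
    push_cast
    ring

open scoped Pointwise in
theorem le_half_of_integrableOn_T244 (a : ℂ) {c ε : ℝ} (hε : 0 < ε)
    (h : IntegrableOn (fun p : ℂ × ℂ => ‖a * p.1 ^ 2 * p.2 ^ 2 + p.1 ^ 4 + p.2 ^ 4‖ ^ (-2 * c))
      (Metric.ball 0 ε)) : c ≤ 1 / 2 := by
  by_contra! hc
  set F : ℂ × ℂ → ℝ :=
    fun p => ‖a * p.1 ^ 2 * p.2 ^ 2 + p.1 ^ 4 + p.2 ^ 4‖ ^ (-2 * c) with hF
  have hF0 (p) : 0 ≤ F p := by positivity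
  have hscale (p : ℂ × ℂ) : F ((1 / 2 : ℝ) • p) = 2 ^ (8 * c) * F p := by
    simp only [hF, Prod.smul_fst, Prod.smul_snd, Complex.real_smul]
    rw [show a * (((1 / 2 : ℝ) : ℂ) * p.1) ^ 2 * (((1 / 2 : ℝ) : ℂ) * p.2) ^ 2 +
      (((1 / 2 : ℝ) : ℂ) * p.1) ^ 4 + (((1 / 2 : ℝ) : ℂ) * p.2) ^ 4 =
      ((1 / 2 : ℝ) : ℂ) ^ 4 * (a * p.1 ^ 2 * p.2 ^ 2 + p.1 ^ 4 + p.2 ^ 4) by ring,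
      norm_mul, norm_pow, Complex.norm_real, Real.mul_rpow (by positivity) (by positivity),
      Real.norm_of_nonneg (by norm_num), ← Real.rpow_natCast, ← Real.rpow_mul (by norm_num),
      one_div, Real.inv_rpow (by norm_num), ← Real.rpow_neg (by norm_num)]
    congr 2
    push_cast
    ring
  have : (volume : Measure (ℂ × ℂ)).IsAddHaarMeasure :=
    Measure.prod.instIsAddHaarMeasure volume volume
  have hint := Measure.setIntegral_comp_smul_of_pos (volume : Measure (ℂ × ℂ)) F
    (Metric.ball 0 ε) (R := 1 / 2) (by norm_num)
  simp only [hscale] at hint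
  rw [integral_const_mul, Module.finrank_prod, Complex.finrank_real_complex, smul_eq_mul] at hint
  have hsub : (1 / 2 : ℝ) • Metric.ball (0 : ℂ × ℂ) ε ⊆ Metric.ball 0 ε := by
    rintro _ ⟨p, hp, rfl⟩
    rw [mem_ball_zero_iff] at hp
    simp only [mem_ball_zero_iff, norm_smul, Real.norm_eq_abs]
    rw [abs_of_pos (by norm_num)]
    linarith [norm_nonneg p]
  have hmono : ∫ p in (1 / 2 : ℝ) • Metric.ball (0 : ℂ × ℂ) ε, F p ≤
      ∫ p in Metric.ball (0 : ℂ × ℂ) ε, F p :=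
    setIntegral_mono_set h (Filter.Eventually.of_forall hF0) hsub.eventuallyLE
  have hpos : 0 < ∫ p in Metric.ball (0 : ℂ × ℂ) ε, F p := by
    rw [setIntegral_pos_iff_support_of_nonneg_ae (Filter.Eventually.of_forall hF0) h]
    have hopen : IsOpen ({p : ℂ × ℂ | a * p.1 ^ 2 * p.2 ^ 2 + p.1 ^ 4 + p.2 ^ 4 ≠ 0} ∩
        Metric.ball 0 ε) :=
      (isOpen_ne_fun (by fun_prop) continuous_const).inter Metric.isOpen_ball
    refine (hopen.measure_pos volume ⟨(((ε / 2 : ℝ) : ℂ), 0), ?_, ?_⟩).trans_le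
      (measure_mono (Set.inter_subset_inter_left _ fun p hp =>
        (Real.rpow_pos_of_pos (norm_pos_iff.2 hp) _).ne'))
    · simp [hε.ne']
    · rw [mem_ball_zero_iff, Prod.norm_def]
      simp only [Complex.norm_real, norm_zero, Real.norm_eq_abs]
      rw [abs_of_pos (by positivity), max_eq_left (by positivity)]
      linarith
  have hgt : (16 : ℝ) < 2 ^ (8 * c) := by
    calc (16 : ℝ) = 2 ^ (4 : ℝ) := by norm_num
      _ < 2 ^ (8 * c) := Real.rpow_lt_rpow_of_exponent_lt (by norm_num) (by linarith)
  norm_num at hint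
  nlinarith

theorem lct_T244 (a : ℂ) (ha : a ^ 2 ≠ 4) :
    lct₀ (fun p : ℂ × ℂ => a * p.1 ^ 2 * p.2 ^ 2 + p.1 ^ 4 + p.2 ^ 4) = 1 / 2 := by
  refine csSup_eq_of_forall_le_of_forall_lt_exists_gt
    ⟨3 / 8, by norm_num, 1, one_pos, integrableOn_T244 ha (by norm_num) (by norm_num)⟩ ?_ ?_
  · rintro c ⟨-, ε, hε, h⟩
    exact le_half_of_integrableOn_T244 a hε h
  · intro w hw
    obtain ⟨c, hc, hc'⟩ := exists_between (max_lt hw (by norm_num : (1 / 4 : ℝ) < 1 / 2))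
    rw [max_lt_iff] at hc
    exact ⟨c, ⟨by linarith, 1, one_pos, integrableOn_T244 ha hc.2 hc'⟩, hc.1⟩
end

section
/- Let q and r be positive integers with 1/q + 1/r < 1/2 and let a be a nonzero complex number. Then the T_{2,q,r} singularity f(x,y) = a x² y² + x^q + y^r satisfies lct₀(f) = 1/2. -/
open MeasureTheory

open scoped ENNReal

/-- A square root of `1 + t` in the right half-plane `re ≥ 1 / 2`. -/
lemma exists_sq_eq_one_add {t : ℂ} (ht : ‖t‖ ≤ 3 / 4) :
    ∃ s : ℂ, s ^ 2 = 1 + t ∧ 1 / 2 ≤ s.re := by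
  obtain ⟨s, hs⟩ := IsAlgClosed.exists_pow_nat_eq (1 + t) (n := 2) (by norm_num)
  have hre : s.re ^ 2 - s.im ^ 2 = 1 + t.re := by
    simpa [pow_two] using congrArg Complex.re hs
  have ht' := (abs_le.mp ((Complex.abs_re_le_norm t).trans ht)).1
  rcases le_total 0 s.re with h | h
  · exact ⟨s, hs, by nlinarith [sq_nonneg s.im]⟩
  · exact ⟨-s, by simpa using hs, by rw [Complex.neg_re]; nlinarith [sq_nonneg s.im]⟩

lemma norm_sub_le_norm_sq_sub_sq {s t : ℂ} (hs : 1 / 2 ≤ s.re) (ht : 1 / 2 ≤ t.re) :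
    ‖s - t‖ ≤ ‖s ^ 2 - t ^ 2‖ := by
  have h1 : 1 ≤ ‖s + t‖ := by
    refine le_trans ?_ (Complex.re_le_norm _)
    rw [Complex.add_re]
    linarith
  rw [sq_sub_sq, norm_mul]
  exact le_mul_of_one_le_left (norm_nonneg _) h1

lemma norm_mul_norm_pow_sub_pow_le {n : ℕ} (hn : 1 ≤ n) {y z : ℂ} (h : ‖y‖ ≤ ‖z‖) :
    ‖z‖ * ‖y ^ n - z ^ n‖ ≤ n * ‖z‖ ^ n * ‖y - z‖ := by
  rw [← (Commute.all y z).geom_sum₂_mul n, norm_mul]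
  have hsum : ‖∑ i ∈ Finset.range n, y ^ i * z ^ (n - 1 - i)‖ ≤ n * ‖z‖ ^ (n - 1) := by
    refine (norm_sum_le_of_le (f := fun i => y ^ i * z ^ (n - 1 - i))
      (n := fun _ => ‖z‖ ^ (n - 1)) _ fun i hi => ?_).trans (by simp)
    have hi' := Finset.mem_range.mp hi
    rw [norm_mul, norm_pow, norm_pow]
    calc ‖y‖ ^ i * ‖z‖ ^ (n - 1 - i) ≤ ‖z‖ ^ i * ‖z‖ ^ (n - 1 - i) := by gcongr
      _ = ‖z‖ ^ (n - 1) := by rw [← pow_add]; congr 1; omega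
  calc ‖z‖ * (‖∑ i ∈ Finset.range n, y ^ i * z ^ (n - 1 - i)‖ * ‖y - z‖)
      ≤ ‖z‖ * (n * ‖z‖ ^ (n - 1) * ‖y - z‖) := by gcongr
    _ = n * (‖z‖ ^ (n - 1) * ‖z‖) * ‖y - z‖ := by ring
    _ = n * ‖z‖ ^ n * ‖y - z‖ := by rw [← pow_succ, Nat.sub_add_cancel hn]

/-- A map of the form `y ↦ y * √(1 + b * y ^ n)` is bi-Lipschitz from below
where `b * y ^ n` is small. -/
lemma norm_sub_le_of_sq_eq {n : ℕ} (hn : 1 ≤ n) {b y z s t : ℂ}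
    (hs : s ^ 2 = 1 + b * y ^ n) (ht : t ^ 2 = 1 + b * z ^ n)
    (hs' : 1 / 2 ≤ s.re) (ht' : 1 / 2 ≤ t.re)
    (hy : 4 * n * ‖b * y ^ n‖ ≤ 1) (hz : 4 * n * ‖b * z ^ n‖ ≤ 1) :
    ‖y - z‖ ≤ 4 * ‖y * s - z * t‖ := by
  wlog h : ‖y‖ ≤ ‖z‖ generalizing y z s t
  · rw [norm_sub_rev y z, norm_sub_rev (y * s)]
    exact this ht hs ht' hs' hz hy (le_of_not_ge h)
  have h1 : ‖s - t‖ ≤ ‖b‖ * ‖y ^ n - z ^ n‖ := by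
    refine (norm_sub_le_norm_sq_sub_sq hs' ht').trans_eq ?_
    rw [hs, ht, ← norm_mul]
    congr 1
    ring
  have h2 : 4 * (‖z‖ * ‖s - t‖) ≤ ‖y - z‖ := by
    calc 4 * (‖z‖ * ‖s - t‖) ≤ 4 * (‖z‖ * (‖b‖ * ‖y ^ n - z ^ n‖)) := by gcongr
      _ = 4 * ‖b‖ * (‖z‖ * ‖y ^ n - z ^ n‖) := by ring
      _ ≤ 4 * ‖b‖ * (n * ‖z‖ ^ n * ‖y - z‖) := by
        gcongr ?_ * ?_
        exact norm_mul_norm_pow_sub_pow_le hn h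
      _ = (4 * n * ‖b * z ^ n‖) * ‖y - z‖ := by rw [norm_mul, norm_pow]; ring
      _ ≤ 1 * ‖y - z‖ := by gcongr
      _ = ‖y - z‖ := one_mul _
  have h3 : 1 / 2 * ‖y - z‖ ≤ ‖s‖ * ‖y - z‖ := by
    gcongr
    exact hs'.trans (Complex.re_le_norm s)
  have h4 : ‖s‖ * ‖y - z‖ ≤ ‖y * s - z * t‖ + ‖z‖ * ‖s - t‖ := by
    rw [← norm_mul, ← norm_mul]
    calc ‖s * (y - z)‖ = ‖(y * s - z * t) - z * (s - t)‖ := by congr 1; ring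
      _ ≤ _ := norm_sub_le _ _
  linarith

/-- On the region where `b * y ^ n` is small, `y ^ 2 * (1 + b * y ^ n) + w` is bounded below by a
product of two linear factors, uniformly in `b` and `w`. -/
lemma exists_norm_mul_norm_le {n : ℕ} (hn : 1 ≤ n) (b w : ℂ) :
    ∃ u v : ℂ, ‖u‖ ≤ 1 ∧ ‖v‖ ≤ 1 ∧ ∀ y : ℂ, ‖y‖ ≤ 1 → 4 * n * ‖b * y ^ n‖ ≤ 1 →
      ‖y - u‖ * ‖y - v‖ ≤ 64 * ‖y ^ 2 * (1 + b * y ^ n) + w‖ := by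
  have hex : ∀ t : ℂ, ∃ s : ℂ, ‖t‖ ≤ 3 / 4 → s ^ 2 = 1 + t ∧ 1 / 2 ≤ s.re := fun t => by
    by_cases ht : ‖t‖ ≤ 3 / 4
    · exact (exists_sq_eq_one_add ht).imp fun _ h _ => h
    · exact ⟨0, fun h => absurd h ht⟩
  choose s hs using hex
  set K : Set ℂ := Metric.closedBall 0 1 ∩ {y | 4 * n * ‖b * y ^ n‖ ≤ 1} with hK
  have hn' : (1 : ℝ) ≤ n := by exact_mod_cast hn
  have hsmall : ∀ y ∈ K, ‖b * y ^ n‖ ≤ 3 / 4 := fun y hy => by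
    have : 4 * n * ‖b * y ^ n‖ ≤ 1 := hy.2
    nlinarith [norm_nonneg (b * y ^ n)]
  have hKc : IsCompact K :=
    (isCompact_closedBall 0 1).inter_right (isClosed_le (by fun_prop) continuous_const)
  have hK0 : K.Nonempty := ⟨0, by simp [hK, show n ≠ 0 by omega]⟩
  have hcont : ContinuousOn s (Metric.closedBall 0 (3 / 4)) := by
    refine LipschitzOnWith.continuousOn (K := 1) (LipschitzOnWith.of_dist_le_mul ?_)
    intro x hx y hy
    rw [mem_closedBall_zero_iff] at hx hy
    obtain ⟨hx1, hx2⟩ := hs x hx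
    obtain ⟨hy1, hy2⟩ := hs y hy
    rw [NNReal.coe_one, one_mul, dist_eq_norm, dist_eq_norm]
    refine (norm_sub_le_norm_sq_sub_sq hx2 hy2).trans_eq ?_
    rw [hx1, hy1, add_sub_add_left_eq_sub]
  have hφ : ContinuousOn (fun y => y * s (b * y ^ n)) K :=
    continuousOn_id.mul (hcont.comp (by fun_prop) fun y hy => by simpa using hsmall y hy)
  have key : ∀ ζ : ℂ, ∃ u ∈ K, ∀ y ∈ K, ‖y - u‖ ≤ 8 * ‖y * s (b * y ^ n) - ζ‖ := fun ζ => by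
    obtain ⟨u, hu, hmin⟩ := hKc.exists_isMinOn hK0 (hφ.sub (continuousOn_const (c := ζ))).norm
    refine ⟨u, hu, fun y hy => ?_⟩
    have h1 := isMinOn_iff.mp hmin y hy
    obtain ⟨hy1, hy2⟩ := hs _ (hsmall y hy)
    obtain ⟨hu1, hu2⟩ := hs _ (hsmall u hu)
    have h2 := norm_sub_le_of_sq_eq hn hy1 hu1 hy2 hu2 hy.2 hu.2
    have h3 := norm_sub_le_norm_sub_add_norm_sub (y * s (b * y ^ n)) ζ (u * s (b * u ^ n))
    rw [norm_sub_rev ζ] at h3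
    simp only [Pi.sub_apply] at h1
    linarith
  obtain ⟨ζ, hζ⟩ := IsAlgClosed.exists_pow_nat_eq (-w) (n := 2) (by norm_num)
  obtain ⟨u, hu, hu'⟩ := key ζ
  obtain ⟨v, hv, hv'⟩ := key (-ζ)
  refine ⟨u, v, by simpa using hu.1, by simpa using hv.1, fun y hy1 hy2 => ?_⟩
  have hy : y ∈ K := ⟨by simpa using hy1, hy2⟩
  obtain ⟨hs1, -⟩ := hs _ (hsmall y hy)
  calc ‖y - u‖ * ‖y - v‖
      ≤ (8 * ‖y * s (b * y ^ n) - ζ‖) * (8 * ‖y * s (b * y ^ n) - -ζ‖) := by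
        gcongr
        exacts [hu' y hy, hv' y hy]
    _ = 64 * ‖(y * s (b * y ^ n) - ζ) * (y * s (b * y ^ n) - -ζ)‖ := by rw [norm_mul]; ring
    _ = 64 * ‖y ^ 2 * (1 + b * y ^ n) + w‖ := by
        congr 2
        linear_combination y ^ 2 * hs1 - hζ

lemma setLIntegral_ball_enorm_rpow_lt_top {α : ℝ} (hα : α < 2) (R : ℝ) :
    ∫⁻ x in Metric.ball (0 : ℂ) R, ‖x‖ₑ ^ (-α) < ∞ := by
  have hint : IntegrableOn (fun x : ℂ => ‖x‖ ^ (-α)) (Metric.ball 0 R) := by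
    refine integrableOn_ball_of_norm_le_rpow (C := 1) (α := α) (by simp) (by simpa using hα)
      (.of_forall fun x => ?_)
      (measurable_norm.pow_const (-α)).aestronglyMeasurable
    rw [one_mul, Real.norm_of_nonneg (by positivity)]
  refine lt_of_eq_of_lt (lintegral_congr_ae ?_) hint.hasFiniteIntegral
  filter_upwards [ae_restrict_of_ae (Measure.ae_ne volume (0 : ℂ))] with x hx
  have hx' : 0 < ‖x‖ := norm_pos_iff.mpr hx
  rw [Real.enorm_of_nonneg (by positivity), ← ENNReal.ofReal_rpow_of_pos hx', ofReal_norm]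

lemma setLIntegral_enorm_sub_rpow_le {u : ℂ} (hu : ‖u‖ ≤ 1) (α : ℝ) :
    ∫⁻ y in Metric.closedBall (0 : ℂ) 1, ‖y - u‖ₑ ^ (-α)
      ≤ ∫⁻ y in Metric.ball (0 : ℂ) 3, ‖y‖ₑ ^ (-α) := by
  have h := (measurePreserving_sub_right volume u).setLIntegral_comp_preimage
    (s := Metric.ball (0 : ℂ) 3) measurableSet_ball
    (f := fun y => ‖y‖ₑ ^ (-α)) (by fun_prop)
  rw [← h]
  refine lintegral_mono_set fun y hy => ?_
  rw [mem_closedBall_zero_iff] at hy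
  rw [Set.mem_preimage, mem_ball_zero_iff]
  linarith [norm_sub_le y u]

lemma ENNReal.rpow_neg_le_of_mul_le {A B F k : ℝ≥0∞} (hk : k ≠ 0) (hk' : k ≠ ∞) {c : ℝ}
    (hc : 0 < c) (h : A * B ≤ k * F) :
    F ^ (-2 * c) ≤ k ^ (2 * c) * (A ^ (-(4 * c)) + B ^ (-(4 * c))) := by
  wlog hAB : A ≤ B generalizing A B
  · rw [add_comm]
    exact this (by rwa [mul_comm]) (le_of_not_ge hAB)
  have hk1 : k ^ (2 * c) ≠ 0 := by simp [ENNReal.rpow_eq_zero_iff, hk, hk']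
  have hk2 : k ^ (2 * c) ≠ ∞ := ENNReal.rpow_ne_top_of_nonneg (by positivity) hk'
  have h1 : A ^ (4 * c) ≤ k ^ (2 * c) * F ^ (2 * c) := by
    rw [← ENNReal.mul_rpow_of_nonneg _ _ (by positivity),
      show 4 * c = (2 : ℝ) * (2 * c) by ring, ENNReal.rpow_mul]
    refine ENNReal.rpow_le_rpow ?_ (by positivity)
    rw [ENNReal.rpow_two, sq]
    exact (mul_le_mul_right hAB A).trans h
  have h2 : k ^ (2 * c) * (k ^ (2 * c) * F ^ (2 * c))⁻¹ = F ^ (-2 * c) := by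
    rw [ENNReal.mul_inv (.inl hk1) (.inl hk2), ← mul_assoc, ENNReal.mul_inv_cancel hk1 hk2,
      one_mul, neg_mul, ENNReal.rpow_neg]
  rw [← h2]
  gcongr
  refine le_trans ?_ le_self_add
  rw [ENNReal.rpow_neg]
  exact ENNReal.inv_le_inv.mpr h1

lemma measurableSet_norm_le_one_and (n : ℕ) (b : ℂ) :
    MeasurableSet {y : ℂ | ‖y‖ ≤ 1 ∧ 4 * n * ‖b * y ^ n‖ ≤ 1} :=
  ((isClosed_le (by fun_prop : Continuous fun y : ℂ => ‖y‖) continuous_const).inter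
    (isClosed_le (by fun_prop : Continuous fun y : ℂ => 4 * n * ‖b * y ^ n‖)
      continuous_const)).measurableSet

lemma exists_setLIntegral_rpow_le {c : ℝ} (hc : 0 < c) (hc' : c < 1 / 2) :
    ∃ C : ℝ≥0∞, C ≠ ∞ ∧ ∀ (n : ℕ), 1 ≤ n → ∀ b w : ℂ,
      ∫⁻ y in {y : ℂ | ‖y‖ ≤ 1 ∧ 4 * n * ‖b * y ^ n‖ ≤ 1},
        ‖y ^ 2 * (1 + b * y ^ n) + w‖ₑ ^ (-2 * c) ≤ C := by
  set I := ∫⁻ y in Metric.ball (0 : ℂ) 3, ‖y‖ₑ ^ (-(4 * c)) with hI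
  have hI' : I ≠ ∞ := (setLIntegral_ball_enorm_rpow_lt_top (by linarith) 3).ne
  have h64 : (64 : ℝ≥0∞) ^ (2 * c) ≠ ∞ :=
    ENNReal.rpow_ne_top_of_nonneg (by positivity) (by norm_num)
  refine ⟨64 ^ (2 * c) * (I + I),
    ENNReal.mul_ne_top h64 (ENNReal.add_ne_top.mpr ⟨hI', hI'⟩), fun n hn b w => ?_⟩
  obtain ⟨u, v, hu, hv, huv⟩ := exists_norm_mul_norm_le hn b w
  set K := {y : ℂ | ‖y‖ ≤ 1 ∧ 4 * n * ‖b * y ^ n‖ ≤ 1} with hK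
  have hKm : MeasurableSet K := measurableSet_norm_le_one_and n b
  calc ∫⁻ y in K, ‖y ^ 2 * (1 + b * y ^ n) + w‖ₑ ^ (-2 * c)
      ≤ ∫⁻ y in K, 64 ^ (2 * c) * (‖y - u‖ₑ ^ (-(4 * c)) + ‖y - v‖ₑ ^ (-(4 * c))) := by
        refine setLIntegral_mono' hKm fun y hy => ?_
        refine ENNReal.rpow_neg_le_of_mul_le (by norm_num) (by norm_num) hc ?_
        have h := ENNReal.ofReal_le_ofReal (huv y hy.1 hy.2)
        rwa [ENNReal.ofReal_mul (norm_nonneg _), ENNReal.ofReal_mul (by norm_num), ofReal_norm,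
          ofReal_norm, ofReal_norm, ENNReal.ofReal_ofNat] at h
    _ ≤ ∫⁻ y in Metric.closedBall (0 : ℂ) 1,
          64 ^ (2 * c) * (‖y - u‖ₑ ^ (-(4 * c)) + ‖y - v‖ₑ ^ (-(4 * c))) :=
        lintegral_mono_set fun y hy => by simpa using hy.1
    _ = 64 ^ (2 * c) * ((∫⁻ y in Metric.closedBall (0 : ℂ) 1, ‖y - u‖ₑ ^ (-(4 * c)))
          + ∫⁻ y in Metric.closedBall (0 : ℂ) 1, ‖y - v‖ₑ ^ (-(4 * c))) := by
        rw [lintegral_const_mul' _ _ h64, lintegral_add_left (by fun_prop)]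
    _ ≤ 64 ^ (2 * c) * (I + I) := by
        gcongr
        exacts [setLIntegral_enorm_sub_rpow_le hu _, setLIntegral_enorm_sub_rpow_le hv _]

/-- The part of the unit bidisc on which `y ^ (n + 2)` is dominated by `a * x ^ 2 * y ^ 2`. -/
def dominatedRegion (a : ℂ) (n : ℕ) : Set (ℂ × ℂ) :=
  {p | ‖p.1‖ < 1 ∧ ‖p.2‖ ≤ 1 ∧ 4 * n * ‖p.2‖ ^ n ≤ ‖a‖ * ‖p.1‖ ^ 2}

lemma measurableSet_dominatedRegion (a : ℂ) (n : ℕ) : MeasurableSet (dominatedRegion a n) :=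
  (measurableSet_lt (by fun_prop : Measurable fun p : ℂ × ℂ => ‖p.1‖) measurable_const).inter
    ((measurableSet_le (by fun_prop : Measurable fun p : ℂ × ℂ => ‖p.2‖) measurable_const).inter
      (measurableSet_le (by fun_prop : Measurable fun p : ℂ × ℂ => 4 * n * ‖p.2‖ ^ n)
        (by fun_prop : Measurable fun p : ℂ × ℂ => ‖a‖ * ‖p.1‖ ^ 2)))

lemma setLIntegral_dominatedRegion_lt_top {c : ℝ} (hc : 0 < c) (hc' : c < 1 / 2) {a : ℂ}
    (ha : a ≠ 0) {n : ℕ} (hn : 1 ≤ n) {g : ℂ → ℂ} (hg : Measurable g) :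
    ∫⁻ p in dominatedRegion a n, ‖a * p.1 ^ 2 * p.2 ^ 2 + g p.1 + p.2 ^ (n + 2)‖ₑ ^ (-2 * c)
      < ∞ := by
  obtain ⟨C, hC, hbound⟩ := exists_setLIntegral_rpow_le hc hc'
  have hS := measurableSet_dominatedRegion a n
  set F : ℂ × ℂ → ℝ≥0∞ :=
    fun p => ‖a * p.1 ^ 2 * p.2 ^ 2 + g p.1 + p.2 ^ (n + 2)‖ₑ ^ (-2 * c) with hF
  have hFm : Measurable F := by fun_prop
  rw [← lintegral_indicator hS, Measure.volume_eq_prod,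
    lintegral_prod _ (hFm.indicator hS).aemeasurable]
  have hfiber : ∀ x : ℂ, x ≠ 0 → ∫⁻ y, (dominatedRegion a n).indicator F (x, y)
      ≤ (Metric.ball (0 : ℂ) 1).indicator
        (fun x => ‖a‖ₑ ^ (-2 * c) * C * ‖x‖ₑ ^ (-(4 * c))) x := fun x hx => by
    by_cases hx1 : ‖x‖ < 1
    swap
    · have : ∀ y, (dominatedRegion a n).indicator F (x, y) = 0 := fun y =>
        Set.indicator_of_notMem (fun h => hx1 h.1) _
      simp [this]
    rw [Set.indicator_of_mem (by simpa using hx1)]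
    set K := {y : ℂ | ‖y‖ ≤ 1 ∧ 4 * n * ‖(a * x ^ 2)⁻¹ * y ^ n‖ ≤ 1} with hK
    have hKm : MeasurableSet K := measurableSet_norm_le_one_and n _
    have hax : a * x ^ 2 ≠ 0 := mul_ne_zero ha (pow_ne_zero _ hx)
    have hax' : 0 < ‖a‖ * ‖x‖ ^ 2 := by positivity
    have heq : ∀ y, (dominatedRegion a n).indicator F (x, y) = K.indicator (fun y =>
        ‖a * x ^ 2‖ₑ ^ (-2 * c) *
          ‖y ^ 2 * (1 + (a * x ^ 2)⁻¹ * y ^ n) + g x / (a * x ^ 2)‖ₑ ^ (-2 * c)) y := fun y => by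
      have hmem : (x, y) ∈ dominatedRegion a n ↔ y ∈ K := by
        simp only [dominatedRegion, hK, Set.mem_ofPred_eq, hx1, true_and, norm_mul, norm_inv,
          norm_pow]
        rw [mul_left_comm, inv_mul_le_one₀ hax']
      by_cases hy : y ∈ K
      · have hfactor : a * x ^ 2 * y ^ 2 + g x + y ^ (n + 2) = a * x ^ 2 *
            (y ^ 2 * (1 + (a * x ^ 2)⁻¹ * y ^ n) + g x / (a * x ^ 2)) := by
          field_simp
          ring
        rw [Set.indicator_of_mem hy, Set.indicator_of_mem (hmem.mpr hy),
          ← ENNReal.mul_rpow_of_ne_top enorm_ne_top enorm_ne_top, ← enorm_mul, ← hfactor]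
      · rw [Set.indicator_of_notMem hy, Set.indicator_of_notMem (mt hmem.mp hy)]
    simp_rw [heq]
    rw [lintegral_indicator hKm, lintegral_const_mul _ (by fun_prop)]
    calc ‖a * x ^ 2‖ₑ ^ (-2 * c) * _ ≤ ‖a * x ^ 2‖ₑ ^ (-2 * c) * C := by
          gcongr
          exact hbound n hn _ _
      _ = ‖a‖ₑ ^ (-2 * c) * C * ‖x‖ₑ ^ (-(4 * c)) := by
          rw [enorm_mul, enorm_pow, ENNReal.mul_rpow_of_ne_top enorm_ne_top (by simp),
            ← ENNReal.rpow_natCast, ← ENNReal.rpow_mul,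
            show ((2 : ℕ) : ℝ) * (-2 * c) = -(4 * c) by push_cast; ring]
          ring
  refine (lintegral_mono_ae ((Measure.ae_ne volume (0 : ℂ)).mono hfiber)).trans_lt ?_
  rw [lintegral_indicator measurableSet_ball, lintegral_const_mul _ (by fun_prop)]
  refine ENNReal.mul_lt_top (ENNReal.mul_lt_top ?_ hC.lt_top)
    (setLIntegral_ball_enorm_rpow_lt_top (by linarith) 1)
  rw [neg_mul, ENNReal.rpow_neg, ENNReal.inv_lt_top]
  exact ENNReal.rpow_pos (enorm_pos.mpr ha) enorm_ne_top

/-- Close to the origin, one of the two pure powers is dominated by the mixed term. -/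
lemma exists_ball_subset_dominatedRegion {m n : ℕ} (hmn : 5 ≤ m * n) {a : ℂ} (ha : a ≠ 0) :
    ∃ ε : ℝ, 0 < ε ∧ Metric.ball (0 : ℂ × ℂ) ε ⊆
      dominatedRegion a n ∪ Prod.swap ⁻¹' dominatedRegion a m := by
  have ha' : 0 < ‖a‖ := norm_pos_iff.mpr ha
  set L : ℝ := (4 * m) ^ 2 * (4 * n / ‖a‖) ^ m with hL
  have hL0 : 0 ≤ L := by positivity
  refine ⟨min 1 (‖a‖ ^ 2 / (L + 1)), by positivity, fun p hp => ?_⟩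
  rw [mem_ball_zero_iff, Prod.norm_def, max_lt_iff, lt_min_iff, lt_min_iff] at hp
  obtain ⟨⟨hx1, hx2⟩, hy1, hy2⟩ := hp
  by_contra hcon
  rw [Set.mem_union, not_or] at hcon
  have hA : ‖a‖ * ‖p.1‖ ^ 2 < 4 * n * ‖p.2‖ ^ n := by
    by_contra! h
    exact hcon.1 ⟨hx1, hy1.le, h⟩
  have hB : ‖a‖ * ‖p.2‖ ^ 2 < 4 * m * ‖p.1‖ ^ m := by
    by_contra! h
    exact hcon.2 ⟨hy1, hx1.le, h⟩
  generalize ‖p.1‖ = X at *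
  have hY0 := norm_nonneg p.2
  generalize ‖p.2‖ = Y at *
  have hn0 : n ≠ 0 := by rintro rfl; omega
  have hY : 0 < Y := by
    refine hY0.lt_of_ne' fun h => ?_
    rw [h, zero_pow hn0] at hA
    nlinarith [sq_nonneg X]
  have hX2 : X ^ 2 ≤ 4 * n / ‖a‖ * Y ^ n := by
    rw [div_mul_eq_mul_div, le_div_iff₀ ha']
    linarith
  have h1 : ‖a‖ ^ 2 * Y ^ 4 ≤ L * Y ^ (m * n) := by
    calc ‖a‖ ^ 2 * Y ^ 4 = (‖a‖ * Y ^ 2) ^ 2 := by ring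
      _ ≤ (4 * m * X ^ m) ^ 2 := by gcongr
      _ = (4 * m) ^ 2 * (X ^ 2) ^ m := by ring
      _ ≤ (4 * m) ^ 2 * (4 * n / ‖a‖ * Y ^ n) ^ m := by gcongr
      _ = L * Y ^ (m * n) := by
        rw [mul_pow (4 * n / ‖a‖) (Y ^ n), ← pow_mul, hL, mul_comm n m]
        ring
  have h2 : L * Y ^ (m * n) ≤ L * Y ^ 5 :=
    mul_le_mul_of_nonneg_left (pow_le_pow_of_le_one hY0 hy1.le hmn) hL0
  have h3 : ‖a‖ ^ 2 ≤ L * Y := by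
    refine le_of_mul_le_mul_right ?_ (pow_pos hY 4)
    calc _ ≤ L * Y ^ 5 := h1.trans h2
      _ = L * Y * Y ^ 4 := by ring
  rw [lt_div_iff₀ (by positivity)] at hy2
  linarith

lemma integrableOn_of_lt_half {m n : ℕ} (hm : 1 ≤ m) (hn : 1 ≤ n) (hmn : 5 ≤ m * n) {a : ℂ}
    (ha : a ≠ 0) {c : ℝ} (hc : 0 < c) (hc' : c < 1 / 2) :
    ∃ ε : ℝ, 0 < ε ∧ IntegrableOn
      (fun p : ℂ × ℂ => ‖a * p.1 ^ 2 * p.2 ^ 2 + p.1 ^ (m + 2) + p.2 ^ (n + 2)‖ ^ (-2 * c))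
      (Metric.ball 0 ε) := by
  obtain ⟨ε, hε, hsub⟩ := exists_ball_subset_dominatedRegion hmn ha
  refine ⟨ε, hε, ?_, ?_⟩
  · exact (Measurable.pow_const (by fun_prop) _).aestronglyMeasurable
  have hA := setLIntegral_dominatedRegion_lt_top hc hc' ha hn (g := fun x => x ^ (m + 2))
    (by fun_prop)
  have hB := setLIntegral_dominatedRegion_lt_top hc hc' ha hm (g := fun x => x ^ (n + 2))
    (by fun_prop)
  have hswap : MeasurePreserving (Prod.swap : ℂ × ℂ → ℂ × ℂ) volume volume :=
    Measure.measurePreserving_swap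
  rw [← hswap.setLIntegral_comp_preimage (measurableSet_dominatedRegion a m) (by fun_prop)] at hB
  have hle : ∀ z : ℂ, ‖‖z‖ ^ (-2 * c)‖ₑ ≤ ‖z‖ₑ ^ (-2 * c) := fun z => by
    rcases eq_or_ne z 0 with rfl | hz
    · rw [enorm_zero, ENNReal.zero_rpow_of_neg (by linarith)]
      exact le_top
    · rw [Real.enorm_of_nonneg (by positivity),
        ← ENNReal.ofReal_rpow_of_pos (norm_pos_iff.mpr hz), ofReal_norm]
  refine (lintegral_mono fun p => hle _).trans_lt ((lintegral_mono_set hsub).trans_lt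
    ((lintegral_union_le _ _ _).trans_lt (ENNReal.add_lt_top.mpr ⟨hA, lt_of_eq_of_lt ?_ hB⟩)))
  refine lintegral_congr fun p => ?_
  rw [Prod.fst_swap, Prod.snd_swap, add_right_comm]
  congr 4
  ring

/-- The bidisc of radii `δ ^ r / 4`, `δ ^ q / 4` around `(3 / 4 * δ ^ r, 3 / 4 * δ ^ q)`. -/
def weightedBidisc (q r : ℕ) (δ : ℝ) : Set (ℂ × ℂ) :=
  Metric.ball ((3 / 4 * δ ^ r : ℝ) : ℂ) (δ ^ r / 4) ×ˢ
    Metric.ball ((3 / 4 * δ ^ q : ℝ) : ℂ) (δ ^ q / 4)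

lemma norm_mem_Ioo_of_mem_ball {ρ : ℝ} (hρ : 0 < ρ) {x : ℂ}
    (hx : x ∈ Metric.ball ((3 / 4 * ρ : ℝ) : ℂ) (ρ / 4)) : ‖x‖ ∈ Set.Ioo (ρ / 2) ρ := by
  rw [mem_ball_iff_norm] at hx
  have h := abs_lt.mp ((abs_norm_sub_norm_le x _).trans_lt hx)
  rw [Complex.norm_real, Real.norm_of_nonneg (by positivity)] at h
  constructor <;> linarith [h.1, h.2]

lemma volume_weightedBidisc (q r : ℕ) {δ : ℝ} (hδ : 0 < δ) :
    volume.real (weightedBidisc q r δ) = (Real.pi / 16) ^ 2 * (δ ^ (q + r)) ^ 2 := by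
  rw [weightedBidisc, Measure.volume_eq_prod, measureReal_prod_prod, measureReal_def,
    measureReal_def, Complex.volume_ball, Complex.volume_ball]
  simp only [ENNReal.toReal_mul, ENNReal.toReal_pow, ENNReal.coe_toReal, NNReal.coe_real_pi]
  rw [ENNReal.toReal_ofReal (by positivity), ENNReal.toReal_ofReal (by positivity)]
  ring

lemma norm_bounds_of_mem_weightedBidisc {q r : ℕ} (hqr : 2 * (q + r) + 1 ≤ q * r) {a : ℂ}
    {δ : ℝ} (hδ : 0 < δ) (hδ1 : δ < 1) (hδa : δ < ‖a‖ / 32) {p : ℂ × ℂ}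
    (hp : p ∈ weightedBidisc q r δ) :
    0 < ‖a * p.1 ^ 2 * p.2 ^ 2 + p.1 ^ q + p.2 ^ r‖ ∧
      ‖a * p.1 ^ 2 * p.2 ^ 2 + p.1 ^ q + p.2 ^ r‖ ≤ (‖a‖ + 2) * (δ ^ (q + r)) ^ 2 := by
  obtain ⟨hx1, hx2⟩ := norm_mem_Ioo_of_mem_ball (pow_pos hδ r) hp.1
  obtain ⟨hy1, hy2⟩ := norm_mem_Ioo_of_mem_ball (pow_pos hδ q) hp.2
  set D := (δ ^ (q + r)) ^ 2 with hD
  have hD0 : 0 < D := by positivity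
  have hmix : ‖a * p.1 ^ 2 * p.2 ^ 2‖ = ‖a‖ * ‖p.1‖ ^ 2 * ‖p.2‖ ^ 2 := by
    simp only [norm_mul, norm_pow]
  have hmix_le : ‖a * p.1 ^ 2 * p.2 ^ 2‖ ≤ ‖a‖ * D := by
    calc _ ≤ ‖a‖ * (δ ^ r) ^ 2 * (δ ^ q) ^ 2 := by rw [hmix]; gcongr
      _ = ‖a‖ * D := by rw [hD]; ring
  have hmix_ge : ‖a‖ * D / 16 ≤ ‖a * p.1 ^ 2 * p.2 ^ 2‖ := by
    calc ‖a‖ * D / 16 = ‖a‖ * (δ ^ r / 2) ^ 2 * (δ ^ q / 2) ^ 2 := by rw [hD]; ring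
      _ ≤ _ := by rw [hmix]; gcongr
  have hpow : δ ^ (q * r) ≤ δ * D := by
    calc δ ^ (q * r) ≤ δ ^ (2 * (q + r) + 1) := pow_le_pow_of_le_one hδ.le hδ1.le hqr
      _ = δ * D := by rw [hD]; ring
  have hxq : ‖p.1 ^ q‖ ≤ δ * D := by
    refine le_trans ?_ hpow
    rw [norm_pow, mul_comm q r, pow_mul]
    gcongr
  have hyr : ‖p.2 ^ r‖ ≤ δ * D := by
    refine le_trans ?_ hpow
    rw [norm_pow, pow_mul]
    gcongr
  have h1 := norm_add₃_le (a := a * p.1 ^ 2 * p.2 ^ 2) (b := p.1 ^ q) (c := p.2 ^ r)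
  have h2 : ‖a * p.1 ^ 2 * p.2 ^ 2‖ ≤
      ‖a * p.1 ^ 2 * p.2 ^ 2 + p.1 ^ q + p.2 ^ r‖ + ‖p.1 ^ q‖ + ‖p.2 ^ r‖ := by
    calc _ = ‖(a * p.1 ^ 2 * p.2 ^ 2 + p.1 ^ q + p.2 ^ r) - p.1 ^ q - p.2 ^ r‖ := by
          congr 1; ring
      _ ≤ _ := (norm_sub_le _ _).trans (by gcongr; exact norm_sub_le _ _)
  constructor <;> nlinarith

lemma weightedBidisc_subset_ball {q r : ℕ} (hq : 1 ≤ q) (hr : 1 ≤ r) {δ ε : ℝ} (hδ : 0 < δ)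
    (hδ1 : δ < 1) (hδε : δ < ε) : weightedBidisc q r δ ⊆ Metric.ball 0 ε := fun p hp => by
  have hx := (norm_mem_Ioo_of_mem_ball (pow_pos hδ r) hp.1).2
  have hy := (norm_mem_Ioo_of_mem_ball (pow_pos hδ q) hp.2).2
  have hr' := pow_le_of_le_one hδ.le hδ1.le (show r ≠ 0 by omega)
  have hq' := pow_le_of_le_one hδ.le hδ1.le (show q ≠ 0 by omega)
  rw [mem_ball_zero_iff, Prod.norm_def, max_lt_iff]
  constructor <;> linarith

lemma le_half_of_integrableOn {q r : ℕ} (hq : 1 ≤ q) (hr : 1 ≤ r)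
    (hqr : 2 * (q + r) + 1 ≤ q * r) {a : ℂ} (ha : a ≠ 0) {c ε : ℝ} (hε : 0 < ε)
    (hint : IntegrableOn (fun p : ℂ × ℂ => ‖a * p.1 ^ 2 * p.2 ^ 2 + p.1 ^ q + p.2 ^ r‖ ^ (-2 * c))
      (Metric.ball 0 ε)) : c ≤ 1 / 2 := by
  by_contra! hc
  set f : ℂ × ℂ → ℝ := fun p => ‖a * p.1 ^ 2 * p.2 ^ 2 + p.1 ^ q + p.2 ^ r‖ ^ (-2 * c) with hf
  set M := ∫ p in Metric.ball 0 ε, f p with hM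
  have ha' : 0 < ‖a‖ := norm_pos_iff.mpr ha
  set K : ℝ := (Real.pi / 16) ^ 2 * (‖a‖ + 2) ^ (-2 * c) with hK
  have hK0 : 0 < K := by positivity
  have hbound : ∀ δ : ℝ, 0 < δ → δ < min (min 1 ε) (‖a‖ / 32) →
      K * (δ ^ (q + r)) ^ (2 - 4 * c) ≤ M := fun δ hδ hδ' => by
    rw [lt_min_iff, lt_min_iff] at hδ'
    obtain ⟨⟨hδ1, hδε⟩, hδa⟩ := hδ'
    have hsub := weightedBidisc_subset_ball hq hr hδ hδ1 hδε
    have hmeas : MeasurableSet (weightedBidisc q r δ) := measurableSet_ball.prod measurableSet_ball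
    have hfin : volume (weightedBidisc q r δ) ≠ ∞ :=
      ((measure_mono hsub).trans_lt measure_ball_lt_top).ne
    set D := δ ^ (q + r) with hD
    have hD0 : 0 < D := by positivity
    calc K * D ^ (2 - 4 * c)
        = ((‖a‖ + 2) * D ^ 2) ^ (-2 * c) * volume.real (weightedBidisc q r δ) := by
          rw [volume_weightedBidisc q r hδ, ← hD, hK, Real.mul_rpow (by positivity) (by positivity),
            ← Real.rpow_natCast D 2, ← Real.rpow_mul hD0.le,
            show 2 - 4 * c = ((2 : ℕ) : ℝ) * (-2 * c) + (2 : ℕ) by push_cast; ring,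
            Real.rpow_add hD0]
          ring
      _ ≤ ∫ p in weightedBidisc q r δ, f p := by
          refine setIntegral_ge_of_const_le_real hmeas hfin (fun p hp => ?_) (hint.mono_set hsub)
          obtain ⟨h0, h1⟩ := norm_bounds_of_mem_weightedBidisc hqr hδ hδ1 hδa hp
          exact Real.rpow_le_rpow_of_nonpos h0 h1 (by linarith)
      _ ≤ M := setIntegral_mono_set hint (.of_forall fun p => by positivity) hsub.eventuallyLE
  have hpow : Filter.Tendsto (fun δ : ℝ => δ ^ (q + r)) (nhdsWithin 0 (Set.Ioi 0))
      (nhdsWithin 0 (Set.Ioi 0)) := by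
    refine tendsto_nhdsWithin_iff.mpr ⟨?_, ?_⟩
    swap
    · exact eventually_mem_nhdsWithin.mono fun δ (hδ : 0 < δ) => Set.mem_Ioi.mpr (pow_pos hδ _)
    have : Filter.Tendsto (fun δ : ℝ => δ ^ (q + r)) (nhds 0) (nhds (0 ^ (q + r))) :=
      (continuous_pow _).tendsto 0
    rw [zero_pow (by omega)] at this
    exact this.mono_left nhdsWithin_le_nhds
  have htop := ((tendsto_rpow_neg_nhdsGT_zero (show 2 - 4 * c < 0 by linarith)).comp
    hpow).const_mul_atTop hK0
  have hsmall : ∀ᶠ δ : ℝ in nhdsWithin 0 (Set.Ioi 0), δ < min (min 1 ε) (‖a‖ / 32) :=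
    nhdsWithin_le_nhds (Iio_mem_nhds (by positivity))
  obtain ⟨δ, ⟨h1, h2⟩, h3⟩ :=
    ((htop.eventually_gt_atTop M).and hsmall).and eventually_mem_nhdsWithin |>.exists
  exact absurd h1 (not_lt.mpr (hbound δ h3 h2))

theorem lct_T2qr (q r : ℕ) (hq : 1 ≤ q) (hr : 1 ≤ r)
    (hqr : (1 : ℚ) / q + 1 / r < 1 / 2) (a : ℂ) (ha : a ≠ 0) :
    lct₀ (fun p : ℂ × ℂ => a * p.1 ^ 2 * p.2 ^ 2 + p.1 ^ q + p.2 ^ r) = 1 / 2 := by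
  have hqr' : 2 * (q + r) + 1 ≤ q * r := by
    have hq0 : (0 : ℚ) < q := by exact_mod_cast hq
    have hr0 : (0 : ℚ) < r := by exact_mod_cast hr
    rw [div_add_div _ _ hq0.ne' hr0.ne', div_lt_div_iff₀ (by positivity) (by norm_num)] at hqr
    have : 2 * (q + r) < q * r := by
      have h : (2 * (q + r) : ℚ) < q * r := by linarith
      exact_mod_cast h
    omega
  obtain ⟨m, rfl, hm⟩ : ∃ m, q = m + 2 ∧ 1 ≤ m := ⟨q - 2, by
    have : 3 ≤ q := by by_contra! h; interval_cases q <;> omega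
    omega⟩
  obtain ⟨n, rfl, hn⟩ : ∃ n, r = n + 2 ∧ 1 ≤ n := ⟨r - 2, by
    have : 3 ≤ r := by by_contra! h; interval_cases r <;> omega
    omega⟩
  have hmn : 5 ≤ m * n := by nlinarith
  refine csSup_eq_of_forall_le_of_forall_lt_exists_gt ?_ ?_ ?_
  · exact ⟨1 / 4, by norm_num,
      integrableOn_of_lt_half hm hn hmn ha (by norm_num) (by norm_num)⟩
  · rintro c ⟨-, ε, hε, hint⟩
    exact le_half_of_integrableOn hq hr hqr' ha hε hint
  · intro w hw
    obtain ⟨c, hwc, hc⟩ := exists_between (max_lt hw (show (0 : ℝ) < 1 / 2 by norm_num))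
    rw [max_lt_iff] at hwc
    exact ⟨c, ⟨hwc.2.le, integrableOn_of_lt_half hm hn hmn ha hwc.2 hc⟩, hwc.1⟩
end

section
/- For every complex number a, the Z₁₁ singularity f(x,y) = x³ y + y⁵ + a x y⁴ satisfies lct₀(f) = 7/15. -/
open MeasureTheory

open Metric

/-- Integrability on `ℂ` of the kernel dominating the powers of a cubic polynomial with separated
roots. -/
lemma integrable_norm_mul_one_add_norm_sq_rpow {c : ℝ} (h₁ : 1 / 3 < c) (h₂ : c < 1) :
    Integrable fun z : ℂ => (‖z‖ * (1 + ‖z‖) ^ 2) ^ (-2 * c) := by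
  have hmeas : AEStronglyMeasurable (fun z : ℂ => (‖z‖ * (1 + ‖z‖) ^ 2) ^ (-2 * c)) volume :=
    Measurable.aestronglyMeasurable (by fun_prop)
  rw [← integrableOn_univ, ← Set.union_compl_self (ball (0 : ℂ) 1)]
  refine IntegrableOn.union ?_ ?_
  · refine integrableOn_ball_of_norm_le_rpow (C := 1) (α := 2 * c) (by simp) (by simp; linarith)
      (.of_forall fun z => ?_) hmeas
    rw [Real.norm_of_nonneg (by positivity), one_mul, ← neg_mul]
    rcases (norm_nonneg z).eq_or_lt with hz | hz
    · simp [← hz]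
    · exact Real.rpow_le_rpow_of_nonpos hz
        (le_mul_of_one_le_right hz.le (one_le_pow₀ (by linarith))) (by linarith)
  · have hdom : Integrable fun z : ℂ => (1 / 2 : ℝ) ^ (-2 * c) * (1 + ‖z‖) ^ (-(6 * c)) :=
      (integrable_one_add_norm (by simp; linarith)).const_mul _
    refine hdom.integrableOn.mono' hmeas.restrict ?_
    filter_upwards [ae_restrict_mem measurableSet_ball.compl] with z hz
    have hz1 : 1 ≤ ‖z‖ := by simpa using hz
    rw [Real.norm_of_nonneg (by positivity)]
    have h6 : (1 + ‖z‖) ^ (-(6 * c)) = ((1 + ‖z‖) ^ 3) ^ (-2 * c) := by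
      rw [← Real.rpow_natCast, ← Real.rpow_mul (by positivity)]
      congr 1; push_cast; ring
    rw [h6, ← Real.mul_rpow (by positivity) (by positivity)]
    refine Real.rpow_le_rpow_of_nonpos (by positivity) ?_ (by linarith)
    nlinarith [mul_nonneg (sub_nonneg.2 hz1) (sq_nonneg (1 + ‖z‖))]

/-- A monic cubic polynomial without quadratic term splits over `ℂ`. -/
lemma exists_roots_depressed_cubic (b u : ℂ) : ∃ r s t : ℂ, r + s + t = 0 ∧
    r * s + r * t + s * t = b ∧ r * s * t = -u := by
  obtain ⟨r, hr⟩ : ∃ r : ℂ, r ^ 3 + b * r + u = 0 := by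
    have hdeg : (Polynomial.X ^ 3 + Polynomial.C b * Polynomial.X + Polynomial.C u).degree = 3 := by
      compute_degree!
    obtain ⟨r, hr⟩ := IsAlgClosed.exists_root _ (by rw [hdeg]; decide)
    exact ⟨r, by simpa using hr⟩
  obtain ⟨w, hw⟩ := IsAlgClosed.exists_pow_nat_eq (-3 * r ^ 2 - 4 * b) two_pos
  refine ⟨r, (-r + w) / 2, (-r - w) / 2, by ring, ?_, ?_⟩
  · linear_combination (-1 / 4) * hw
  · linear_combination (-r / 4) * hw + hr

/-- The root `r` of `X ^ 3 + b X + u` is at distance at least `1 / 8` of the root `s`. -/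
lemma eighth_le_norm_sub_of_root {b u r s t : ℂ} (hb : ‖b‖ ≤ 1 / 10) (hu : ‖u‖ = 1)
    (h₁ : r + s + t = 0) (h₂ : r * s + r * t + s * t = b) (h₃ : r * s * t = -u) :
    1 / 8 ≤ ‖r - s‖ := by
  have hroot : ∀ z : ℂ, z ^ 3 + b * z + u = 0 → 1 / 2 ≤ ‖z‖ ∧ ‖z‖ ≤ 2 := by
    intro z hz
    have hz3 : ‖z‖ ^ 3 = ‖b * z + u‖ := by
      rw [← norm_pow, show z ^ 3 = -(b * z + u) by linear_combination hz, norm_neg]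
    have hbz : ‖b * z‖ ≤ ‖z‖ / 10 := by
      rw [norm_mul]; nlinarith [norm_nonneg z]
    have hup := norm_add_le (b * z) u
    have hlo := norm_sub_le (b * z + u) (b * z)
    rw [add_sub_cancel_left] at hlo
    rw [← hz3] at hup hlo
    have := norm_nonneg z
    constructor
    · by_contra! h
      have : ‖z‖ ^ 3 ≤ (1 / 2) ^ 3 := by gcongr
      linarith
    · by_contra! h
      nlinarith [mul_nonneg this (sq_nonneg (‖z‖ - 2)), mul_self_nonneg (‖z‖ - 2)]
  have hr := hroot r (by rw [← h₂]; linear_combination r ^ 2 * h₁ + h₃)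
  have ht := hroot t (by rw [← h₂]; linear_combination t ^ 2 * h₁ + h₃)
  have hprod : ‖r - s‖ * ‖r - t‖ = ‖3 * r ^ 2 + b‖ := by
    rw [← norm_mul, ← h₂]; congr 1; linear_combination (-2 * r) * h₁
  have hge : 1 / 2 ≤ ‖3 * r ^ 2 + b‖ := by
    have h := norm_sub_le (3 * r ^ 2 + b) b
    rw [add_sub_cancel_right] at h
    simp only [norm_mul, norm_pow, RCLike.norm_ofNat] at h
    nlinarith [hr.1]
  have hrt : ‖r - t‖ ≤ 4 := (norm_sub_le r t).trans (by linarith [hr.2, ht.2])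
  nlinarith [norm_nonneg (r - s)]

/-- If `x` is closest to `r` among three `1 / 8`-separated points `r`, `s`, `t`, the product of its
distances to the three points is controlled by its distance to `r`. -/
lemma norm_mul_one_add_norm_sq_le {x r s t : ℂ} (hrs : 1 / 8 ≤ ‖r - s‖) (hrt : 1 / 8 ≤ ‖r - t‖)
    (hs : ‖x - r‖ ≤ ‖x - s‖) (ht : ‖x - r‖ ≤ ‖x - t‖) :
    1 / 289 * (‖x - r‖ * (1 + ‖x - r‖) ^ 2) ≤ ‖x - r‖ * ‖x - s‖ * ‖x - t‖ := by
  have key : ∀ w : ℂ, 1 / 8 ≤ ‖r - w‖ → ‖x - r‖ ≤ ‖x - w‖ → (1 + ‖x - r‖) / 17 ≤ ‖x - w‖ := by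
    intro w hw hx
    have h := norm_sub_le (x - w) (x - r)
    rw [sub_sub_sub_cancel_left] at h
    linarith
  calc 1 / 289 * (‖x - r‖ * (1 + ‖x - r‖) ^ 2)
      = ‖x - r‖ * ((1 + ‖x - r‖) / 17) * ((1 + ‖x - r‖) / 17) := by ring
    _ ≤ _ := by gcongr <;> [exact key s hrs hs; exact key t hrt ht]

/-- Uniform bound for the integral of a power of a cubic polynomial with separated roots. -/
lemma exists_lintegral_cubic_rpow_le {c : ℝ} (h₁ : 1 / 3 < c) (h₂ : c < 1) :
    ∃ M : ENNReal, M ≠ ⊤ ∧ ∀ b u : ℂ, ‖b‖ ≤ 1 / 10 → ‖u‖ = 1 →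
      ∫⁻ x : ℂ, ENNReal.ofReal (‖x ^ 3 + b * x + u‖ ^ (-2 * c)) ≤ M := by
  set k : ℂ → ℝ := fun z => 1 / 289 * (‖z‖ * (1 + ‖z‖) ^ 2) with hk
  have hk0 : ∀ z, 0 ≤ k z := fun z => by positivity
  set g : ℂ → ENNReal := fun z => ENNReal.ofReal (k z ^ (-2 * c)) with hg
  have hgm : Measurable g := by fun_prop
  have hint : Integrable fun z => k z ^ (-2 * c) := by
    refine ((integrable_norm_mul_one_add_norm_sq_rpow h₁ h₂).const_mul
      ((1 / 289 : ℝ) ^ (-2 * c))).congr (.of_forall fun z => ?_)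
    exact (Real.mul_rpow (by positivity) (by positivity)).symm
  have hfin : ∫⁻ z, g z ≠ ⊤ := hint.lintegral_lt_top.ne
  refine ⟨(∫⁻ z, g z) + ((∫⁻ z, g z) + ∫⁻ z, g z), by simp [hfin], fun b u hb hu => ?_⟩
  obtain ⟨r, s, t, e₁, e₂, e₃⟩ := exists_roots_depressed_cubic b u
  have hfac : ∀ x, ‖x ^ 3 + b * x + u‖ = ‖x - r‖ * ‖x - s‖ * ‖x - t‖ := by
    intro x
    rw [← norm_mul, ← norm_mul]; congr 1
    linear_combination x ^ 2 * e₁ - x * e₂ + e₃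
  have hrs := eighth_le_norm_sub_of_root hb hu e₁ e₂ e₃
  have hrt : 1 / 8 ≤ ‖r - t‖ := eighth_le_norm_sub_of_root (s := t) (t := s) hb hu
    (by linear_combination e₁) (by linear_combination e₂) (by linear_combination e₃)
  have hst : 1 / 8 ≤ ‖s - t‖ := eighth_le_norm_sub_of_root (s := t) (t := r) hb hu
    (by linear_combination e₁) (by linear_combination e₂) (by linear_combination e₃)
  have hsr := hrs
  have htr := hrt
  have hts := hst
  rw [norm_sub_rev] at hsr htr hts
  have hmono : ∀ x w : ℂ, k (x - w) ≤ ‖x ^ 3 + b * x + u‖ → (x = w → ‖x ^ 3 + b * x + u‖ = 0) →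
      ENNReal.ofReal (‖x ^ 3 + b * x + u‖ ^ (-2 * c)) ≤ g (x - w) := by
    intro x w hle h0
    refine ENNReal.ofReal_le_ofReal ?_
    by_cases hxw : x = w
    · rw [h0 hxw, Real.zero_rpow (by linarith)]
      exact Real.rpow_nonneg (hk0 _) _
    · have : 0 < ‖x - w‖ := norm_pos_iff.2 (sub_ne_zero.2 hxw)
      exact Real.rpow_le_rpow_of_nonpos (by positivity) hle (by linarith)
  have hpt : ∀ x : ℂ, ENNReal.ofReal (‖x ^ 3 + b * x + u‖ ^ (-2 * c)) ≤
      g (x - r) + (g (x - s) + g (x - t)) := by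
    intro x
    have hmin : (‖x - r‖ ≤ ‖x - s‖ ∧ ‖x - r‖ ≤ ‖x - t‖) ∨ (‖x - s‖ ≤ ‖x - r‖ ∧ ‖x - s‖ ≤ ‖x - t‖) ∨
        (‖x - t‖ ≤ ‖x - r‖ ∧ ‖x - t‖ ≤ ‖x - s‖) := by grind
    rcases hmin with ⟨ha, hb⟩ | ⟨ha, hb⟩ | ⟨ha, hb⟩
    · refine (hmono x r ?_ ?_).trans le_self_add
      · exact (norm_mul_one_add_norm_sq_le hrs hrt ha hb).trans_eq (hfac x).symm
      · rintro rfl; simp [hfac]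
    · refine (hmono x s ?_ ?_).trans (le_self_add.trans le_add_self)
      · exact (norm_mul_one_add_norm_sq_le hsr hst ha hb).trans_eq (by rw [hfac]; ring)
      · rintro rfl; simp [hfac]
    · refine (hmono x t ?_ ?_).trans (le_add_self.trans le_add_self)
      · exact (norm_mul_one_add_norm_sq_le htr hts ha hb).trans_eq (by rw [hfac]; ring)
      · rintro rfl; simp [hfac]
  have htrans : ∀ w : ℂ, ∫⁻ x, g (x - w) = ∫⁻ x, g x := fun w => lintegral_sub_right_eq_self g w
  calc _ ≤ ∫⁻ x, (g (x - r) + (g (x - s) + g (x - t))) := lintegral_mono hpt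
    _ = _ := by
      rw [lintegral_add_left (by fun_prop), lintegral_add_left (by fun_prop), htrans, htrans,
        htrans]

/-- Change of variables for a homothety of `ℂ`. -/
lemma lintegral_eq_mul_lintegral_comp_mul {g : ℂ → ENNReal} (hg : Measurable g) {R : ℝ}
    (hR : 0 < R) : ∫⁻ x, g x = ENNReal.ofReal (R ^ 2) * ∫⁻ x : ℂ, g (R * x) := by
  have h := congrArg (fun μ : Measure ℂ => ∫⁻ x, g x ∂μ) (Measure.map_addHaar_smul volume hR.ne')
  simp only [lintegral_smul_measure, Complex.finrank_real_complex, smul_eq_mul] at h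
  rw [lintegral_map hg (by fun_prop)] at h
  simp only [Complex.real_smul] at h
  rw [h, ← mul_assoc, ← ENNReal.ofReal_mul (by positivity), abs_of_pos (by positivity),
    mul_inv_cancel₀ (by positivity), ENNReal.ofReal_one, one_mul]

/-- Integration in the first variable of a power of `x ^ 3 * y + y ^ 5 + a * x * y ^ 4`. -/
lemma lintegral_slice_le {a y : ℂ} {c : ℝ} {M : ENNReal}
    (hM : ∀ b u : ℂ, ‖b‖ ≤ 1 / 10 → ‖u‖ = 1 →
      ∫⁻ x : ℂ, ENNReal.ofReal (‖x ^ 3 + b * x + u‖ ^ (-2 * c)) ≤ M)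
    (hy : y ≠ 0) (ha : ‖a‖ ^ 3 * ‖y‖ ≤ 1 / 1000) :
    ∫⁻ x : ℂ, ENNReal.ofReal (‖x ^ 3 * y + y ^ 5 + a * x * y ^ 4‖ ^ (-2 * c)) ≤
      ENNReal.ofReal (‖y‖ ^ (8 / 3 - 10 * c)) * M := by
  have hy0 : 0 < ‖y‖ := norm_pos_iff.2 hy
  set R : ℝ := ‖y‖ ^ (4 / 3 : ℝ) with hRdef
  have hR : 0 < R := by positivity
  have hR3 : R ^ 3 = ‖y‖ ^ 4 := by
    rw [hRdef, ← Real.rpow_natCast, ← Real.rpow_mul hy0.le, ← Real.rpow_natCast]; norm_num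
  have hRC : (R : ℂ) ≠ 0 := by exact_mod_cast hR.ne'
  set b : ℂ := a * y ^ 3 / R ^ 2 with hb
  set u : ℂ := y ^ 4 / R ^ 3 with hu
  have hnR : ‖(R : ℂ)‖ = R := by simp [hR.le]
  have hu1 : ‖u‖ = 1 := by
    rw [hu, norm_div, norm_pow, norm_pow, hnR, hR3, div_self (by positivity)]
  have hb1 : ‖b‖ ≤ 1 / 10 := by
    have h3 : ‖b‖ ^ 3 = ‖a‖ ^ 3 * ‖y‖ := by
      rw [hb, norm_div, norm_mul, norm_pow, norm_pow, hnR, div_pow,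
        show (R ^ 2) ^ 3 = (R ^ 3) ^ 2 by ring, hR3]
      field_simp
    refine le_of_pow_le_pow_left₀ three_ne_zero (by norm_num) ?_
    rw [h3]; linarith
  have hscale : ∀ x : ℂ, ‖(R * x) ^ 3 * y + y ^ 5 + a * (R * x) * y ^ 4‖ =
      ‖y‖ ^ 5 * ‖x ^ 3 + b * x + u‖ := by
    intro x
    have : (R * x) ^ 3 * y + y ^ 5 + a * (R * x) * y ^ 4 =
        y * R ^ 3 * (x ^ 3 + b * x + u) := by
      rw [hb, hu]; field_simp; ring
    rw [this, norm_mul, norm_mul, norm_pow, hnR, hR3]; ring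
  have hpow : R ^ 2 * (‖y‖ ^ 5) ^ (-2 * c) = ‖y‖ ^ (8 / 3 - 10 * c) := by
    rw [hRdef, ← Real.rpow_natCast, ← Real.rpow_natCast, ← Real.rpow_mul hy0.le,
      ← Real.rpow_mul hy0.le, ← Real.rpow_add hy0]
    congr 1; push_cast; ring
  rw [lintegral_eq_mul_lintegral_comp_mul (by fun_prop) hR]
  simp_rw [hscale, Real.mul_rpow (pow_nonneg hy0.le 5) (norm_nonneg _),
    ENNReal.ofReal_mul (Real.rpow_nonneg (pow_nonneg hy0.le 5) (-2 * c))]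
  rw [lintegral_const_mul _ (by fun_prop), ← mul_assoc, ← ENNReal.ofReal_mul (by positivity), hpow]
  gcongr
  exact hM b u hb1 hu1

/-- The exponents in `(1 / 3, 7 / 15)` are admissible for the singularity `Z₁₁`. -/
lemma exists_integrableOn_Z11 (a : ℂ) {c : ℝ} (h₁ : 1 / 3 < c) (h₂ : c < 7 / 15) :
    ∃ ε : ℝ, 0 < ε ∧ IntegrableOn (fun p : ℂ × ℂ =>
      ‖p.1 ^ 3 * p.2 + p.2 ^ 5 + a * p.1 * p.2 ^ 4‖ ^ (-2 * c)) (ball (0 : ℂ × ℂ) ε) volume := by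
  obtain ⟨M, hMtop, hM⟩ := exists_lintegral_cubic_rpow_le h₁ (by linarith : c < 1)
  set ε : ℝ := 1 / (1000 * (‖a‖ ^ 3 + 1)) with hε
  have hε0 : 0 < ε := by positivity
  have haε : ‖a‖ ^ 3 * ε ≤ 1 / 1000 := by
    rw [hε, mul_one_div, div_le_div_iff₀ (by positivity) (by norm_num)]
    linarith
  refine ⟨ε, hε0, Measurable.aestronglyMeasurable (by fun_prop), ?_⟩
  rw [hasFiniteIntegral_iff_ofReal (.of_forall fun p => by positivity),
    show (0 : ℂ × ℂ) = (0, 0) from rfl, ← ball_prod_same, Measure.volume_eq_prod,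
    setLIntegral_prod_symm _ (by fun_prop)]
  have hball : IntegrableOn (fun y : ℂ => ‖y‖ ^ (8 / 3 - 10 * c)) (ball 0 ε) :=
    integrableOn_ball_of_norm_le_rpow (C := 1) (α := 10 * c - 8 / 3) (by simp)
      (by simp; linarith)
      (.of_forall fun y => by rw [Real.norm_of_nonneg (by positivity), one_mul, neg_sub])
      (Measurable.aestronglyMeasurable (by fun_prop))
  calc _ ≤ ∫⁻ y : ℂ in ball 0 ε, ENNReal.ofReal (‖y‖ ^ (8 / 3 - 10 * c)) * M := by
        refine lintegral_mono_ae ?_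
        filter_upwards [ae_restrict_mem measurableSet_ball,
          ae_restrict_of_ae (Measure.ae_ne volume (0 : ℂ))] with y hy hy0
        have hy' : ‖y‖ ≤ ε := (mem_ball_zero_iff.1 hy).le
        exact (setLIntegral_le_lintegral _ _).trans (lintegral_slice_le hM hy0
          ((mul_le_mul_of_nonneg_left hy' (by positivity)).trans haε))
    _ = (∫⁻ y : ℂ in ball 0 ε, ENNReal.ofReal (‖y‖ ^ (8 / 3 - 10 * c))) * M :=
        lintegral_mul_const _ (by fun_prop)
    _ < ⊤ := ENNReal.mul_lt_top hball.lintegral_lt_top hMtop.lt_top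

/-- No exponent greater than `7 / 15` is admissible for the singularity `Z₁₁`. -/
lemma le_of_integrableOn_Z11 (a : ℂ) {c ε : ℝ} (hε : 0 < ε)
    (h : IntegrableOn (fun p : ℂ × ℂ =>
      ‖p.1 ^ 3 * p.2 + p.2 ^ 5 + a * p.1 * p.2 ^ 4‖ ^ (-2 * c)) (ball (0 : ℂ × ℂ) ε) volume) :
    c ≤ 7 / 15 := by
  by_contra! hlt
  set f : ℂ × ℂ → ℂ := fun p => p.1 ^ 3 * p.2 + p.2 ^ 5 + a * p.1 * p.2 ^ 4 with hf
  set σ : ℝ := 1 / (1000 * (‖a‖ + 1)) with hσ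
  have hσ0 : 0 < σ := by positivity
  have haσ : ‖a‖ * σ ≤ 1 / 1000 := by
    rw [hσ, mul_one_div, div_le_div_iff₀ (by positivity) (by norm_num)]; linarith
  have hσ1 : σ ≤ 1 / 1000 := by
    rw [hσ, div_le_div_iff₀ (by positivity) (by norm_num)]; nlinarith [norm_nonneg a]
  set I : ℝ := ∫ p in ball (0 : ℂ × ℂ) ε, ‖f p‖ ^ (-2 * c) with hI
  have hbound : ∀ t : ℝ, 0 < t → t < 1 → 2 * t < ε →
      ∀ p ∈ ball (0 : ℂ) (σ * t ^ 4) ×ˢ ball ((t : ℂ) ^ 3) (t ^ 3 / 2),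
        p ∈ ball (0 : ℂ × ℂ) ε ∧ 0 < ‖f p‖ ∧ ‖f p‖ ≤ 10 * t ^ 15 := by
    rintro t ht ht1 htε ⟨x, y⟩ ⟨hx, hy⟩
    simp only [mem_ball_zero_iff] at hx
    simp only [mem_ball, dist_eq_norm] at hy
    have hnt : ‖(t : ℂ) ^ 3‖ = t ^ 3 := by simp [abs_of_pos ht]
    have hy1 : ‖y‖ ≤ 3 / 2 * t ^ 3 := by
      have := norm_le_norm_add_norm_sub' y ((t : ℂ) ^ 3)
      linarith
    have hy2 : t ^ 3 / 2 ≤ ‖y‖ := by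
      have := norm_sub_norm_le ((t : ℂ) ^ 3) y
      rw [norm_sub_rev] at this
      linarith
    have ht3 : t ^ 3 ≤ t := by simpa using pow_le_pow_of_le_one ht.le ht1.le (show 1 ≤ 3 by norm_num)
    have ht4 : t ^ 4 ≤ t := by simpa using pow_le_pow_of_le_one ht.le ht1.le (show 1 ≤ 4 by norm_num)
    have hA : ‖x ^ 3 * y‖ ≤ 1 / 1000 * t ^ 15 := by
      rw [norm_mul, norm_pow]
      calc ‖x‖ ^ 3 * ‖y‖ ≤ (1 / 1000 * t ^ 4) ^ 3 * (3 / 2 * t ^ 3) := by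
            gcongr; exact hx.le.trans (by gcongr)
        _ = (1 / 1000) ^ 3 * (3 / 2) * t ^ 15 := by ring
        _ ≤ _ := by gcongr; norm_num
    have hB : ‖a * x * y ^ 4‖ ≤ 1 / 100 * t ^ 15 := by
      rw [norm_mul, norm_mul, norm_pow]
      calc ‖a‖ * ‖x‖ * ‖y‖ ^ 4 ≤ ‖a‖ * (σ * t ^ 4) * (3 / 2 * t ^ 3) ^ 4 := by gcongr
        _ = ‖a‖ * σ * (81 / 16) * t ^ 15 * t := by ring
        _ ≤ 1 / 1000 * (81 / 16) * t ^ 15 * 1 := by gcongr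
        _ ≤ 1 / 100 * t ^ 15 := by nlinarith [pow_pos ht 15]
    have hC : ‖y ^ 5‖ ≤ 243 / 32 * t ^ 15 := by
      rw [norm_pow]
      calc ‖y‖ ^ 5 ≤ (3 / 2 * t ^ 3) ^ 5 := by gcongr
        _ = _ := by ring
    have hD : 1 / 32 * t ^ 15 ≤ ‖y ^ 5‖ := by
      rw [norm_pow]
      calc 1 / 32 * t ^ 15 = (t ^ 3 / 2) ^ 5 := by ring
        _ ≤ ‖y‖ ^ 5 := by gcongr
    have ht15 := pow_pos ht 15
    refine ⟨?_, ?_, ?_⟩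
    · rw [mem_ball_zero_iff, Prod.norm_def, max_lt_iff]
      constructor <;> simp only <;> nlinarith
    · have h1 := norm_sub_le (f (x, y)) (x ^ 3 * y + a * x * y ^ 4)
      have h2 := norm_add_le (x ^ 3 * y) (a * x * y ^ 4)
      rw [show f (x, y) - (x ^ 3 * y + a * x * y ^ 4) = y ^ 5 by simp only [hf]; ring] at h1
      linarith
    · have h1 := norm_add_le (x ^ 3 * y + y ^ 5) (a * x * y ^ 4)
      have h2 := norm_add_le (x ^ 3 * y) (y ^ 5)
      simp only [hf]
      linarith
  have hle : ∀ t : ℝ, 0 < t → t < 1 → 2 * t < ε →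
      (10 : ℝ) ^ (-2 * c) * (σ ^ 2 / 4 * Real.pi ^ 2) * t ^ (14 - 30 * c) ≤ I := by
    intro t ht ht1 htε
    have hb := hbound t ht ht1 htε
    set S := ball (0 : ℂ) (σ * t ^ 4) ×ˢ ball ((t : ℂ) ^ 3) (t ^ 3 / 2) with hS
    have hSm : MeasurableSet S := measurableSet_ball.prod measurableSet_ball
    have hvol : volume.real S = σ ^ 2 / 4 * Real.pi ^ 2 * t ^ 14 := by
      rw [hS, Measure.real, Measure.volume_eq_prod, Measure.prod_prod, Complex.volume_ball,
        Complex.volume_ball]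
      simp only [ENNReal.toReal_mul, ENNReal.toReal_pow, ENNReal.coe_toReal, NNReal.coe_real_pi]
      rw [ENNReal.toReal_ofReal (by positivity), ENNReal.toReal_ofReal (by positivity)]
      ring
    have hvtop : volume S ≠ ⊤ := by
      rw [hS, Measure.volume_eq_prod, Measure.prod_prod]
      exact ENNReal.mul_ne_top measure_ball_lt_top.ne measure_ball_lt_top.ne
    calc _ = (10 * t ^ 15) ^ (-2 * c) * volume.real S := by
          rw [hvol, Real.mul_rpow (by norm_num) (by positivity), ← Real.rpow_natCast t 15,
            ← Real.rpow_mul ht.le, ← Real.rpow_natCast t 14,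
            show 14 - 30 * c = ((15 : ℕ) : ℝ) * (-2 * c) + ((14 : ℕ) : ℝ) by push_cast; ring,
            Real.rpow_add ht]
          ring
      _ = ∫ p in S, (10 * t ^ 15) ^ (-2 * c) := by
          rw [setIntegral_const, smul_eq_mul, mul_comm]
      _ ≤ ∫ p in S, ‖f p‖ ^ (-2 * c) :=
          setIntegral_mono_on (integrableOn_const hvtop) (h.mono_set fun p hp => (hb p hp).1) hSm
            fun p hp => Real.rpow_le_rpow_of_nonpos (hb p hp).2.1 (hb p hp).2.2 (by linarith)
      _ ≤ I := setIntegral_mono_set h (.of_forall fun p => by positivity)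
          (.of_forall fun p hp => (hb p hp).1)
  have hlim : Filter.Tendsto
      (fun t : ℝ => (10 : ℝ) ^ (-2 * c) * (σ ^ 2 / 4 * Real.pi ^ 2) * t ^ (14 - 30 * c))
      (nhdsWithin 0 (Set.Ioi 0)) Filter.atTop :=
    (tendsto_rpow_neg_nhdsGT_zero (by linarith)).const_mul_atTop (by positivity)
  have hev := hlim.eventually_gt_atTop I
  have hsmall : ∀ᶠ t : ℝ in nhdsWithin 0 (Set.Ioi 0), t ∈ Set.Ioo 0 (min 1 (ε / 2)) :=
    Ioo_mem_nhdsGT (by positivity)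
  obtain ⟨t, htI, ht0, htm⟩ := (hev.and hsmall).exists
  rw [lt_min_iff] at htm
  exact absurd (hle t ht0 htm.1 (by linarith)) (not_le.2 htI)

theorem lct_Z11 (a : ℂ) :
    lct₀ (fun p : ℂ × ℂ => p.1 ^ 3 * p.2 + p.2 ^ 5 + a * p.1 * p.2 ^ 4) = 7 / 15 := by
  refine csSup_eq_of_forall_le_of_forall_lt_exists_gt ?_ ?_ ?_
  · exact ⟨2 / 5, by norm_num, exists_integrableOn_Z11 a (by norm_num) (by norm_num)⟩
  · rintro c ⟨-, ε, hε, h⟩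
    exact le_of_integrableOn_Z11 a hε h
  · intro w hw
    obtain ⟨c, hc₁, hc₂⟩ := exists_between (max_lt hw (by norm_num : (2 / 5 : ℝ) < 7 / 15))
    rw [max_lt_iff] at hc₁
    exact ⟨c, ⟨by linarith, exists_integrableOn_Z11 a (by linarith) hc₂⟩, hc₁.1⟩
end

section
/- For every complex number a, the Z₁₂ singularity f(x,y) = x³ y + x y⁴ + a x² y³ satisfies lct₀(f) = 5/11. -/
open MeasureTheory

section RpowBounds

/-- A negative power of the largest of three quantities splits over the two smaller ones. -/
lemma rpow_neg_add_le_mul {A B d s t : ℝ} (hA : 0 < A) (hd : 0 < d) (hAB : A ≤ B) (hdB : d ≤ B)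
    (hs : 0 ≤ s) (ht : 0 ≤ t) : B ^ (-(s + t)) ≤ A ^ (-s) * d ^ (-t) := by
  have hB : 0 < B := hA.trans_le hAB
  rw [neg_add, Real.rpow_add hB]
  exact mul_le_mul (Real.rpow_le_rpow_of_nonpos hA hAB (by linarith))
    (Real.rpow_le_rpow_of_nonpos hd hdB (by linarith)) (by positivity) (by positivity)

lemma mul_rpow_neg_le_of_le {A B C d p q : ℝ} (hA : 0 ≤ A) (hd : 0 < d) (hp : 0 < p)
    (hpq : p ≤ q) (hqp : q ≤ 3 * p) (hAB : A ≤ B) (hAC : A ≤ C) (hdB : d ≤ B) (hdC : d ≤ C) :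
    (A * B * C) ^ (-p) ≤ d ^ (-(3 * p - q)) * A ^ (-q) := by
  rcases hA.eq_or_lt with rfl | hA
  · simp only [zero_mul]
    rw [Real.zero_rpow (by linarith), Real.zero_rpow (by linarith), mul_zero]
  have hsum : p = (q - p) / 2 + (3 * p - q) / 2 := by ring
  have hB := rpow_neg_add_le_mul (s := (q - p) / 2) (t := (3 * p - q) / 2) hA hd hAB hdB
    (by linarith) (by linarith)
  have hC := rpow_neg_add_le_mul (s := (q - p) / 2) (t := (3 * p - q) / 2) hA hd hAC hdC
    (by linarith) (by linarith)
  rw [← hsum] at hB hC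
  have hB0 : 0 < B := hA.trans_le hAB
  have hC0 : 0 < C := hA.trans_le hAC
  calc (A * B * C) ^ (-p) = A ^ (-p) * B ^ (-p) * C ^ (-p) := by
        rw [Real.mul_rpow (by positivity) hC0.le, Real.mul_rpow hA.le hB0.le]
    _ ≤ A ^ (-p) * (A ^ (-((q - p) / 2)) * d ^ (-((3 * p - q) / 2))) *
          (A ^ (-((q - p) / 2)) * d ^ (-((3 * p - q) / 2))) := by gcongr
    _ = (d ^ (-((3 * p - q) / 2)) * d ^ (-((3 * p - q) / 2))) *
          (A ^ (-p) * A ^ (-((q - p) / 2)) * A ^ (-((q - p) / 2))) := by ring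
    _ = d ^ (-(3 * p - q)) * A ^ (-q) := by
        rw [← Real.rpow_add hd, ← Real.rpow_add hA, ← Real.rpow_add hA]
        ring_nf

/-- If at most one of `A, B, C` is smaller than `d`, then a negative power of `A * B * C` is
controlled by single powers of the factors. -/
lemma mul_rpow_neg_le_add {A B C d p q : ℝ} (hA : 0 ≤ A) (hB : 0 ≤ B) (hC : 0 ≤ C) (hd : 0 < d)
    (hp : 0 < p) (hpq : p ≤ q) (hqp : q ≤ 3 * p) (hAB : 2 * d ≤ A + B) (hAC : 2 * d ≤ A + C)
    (hBC : 2 * d ≤ B + C) :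
    (A * B * C) ^ (-p) ≤ d ^ (-(3 * p - q)) * (A ^ (-q) + B ^ (-q) + C ^ (-q)) := by
  have hA' : 0 ≤ A ^ (-q) := by positivity
  have hB' : 0 ≤ B ^ (-q) := by positivity
  have hC' : 0 ≤ C ^ (-q) := by positivity
  have hd' : 0 ≤ d ^ (-(3 * p - q)) := by positivity
  by_cases hmA : A ≤ B ∧ A ≤ C
  · refine (mul_rpow_neg_le_of_le hA hd hp hpq hqp hmA.1 hmA.2
      (by linarith [hmA.1]) (by linarith [hmA.2])).trans ?_
    gcongr
    linarith
  by_cases hmB : B ≤ A ∧ B ≤ C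
  · rw [show A * B * C = B * A * C by ring]
    refine (mul_rpow_neg_le_of_le hB hd hp hpq hqp hmB.1 hmB.2
      (by linarith [hmB.1]) (by linarith [hmB.2])).trans ?_
    gcongr
    linarith
  have hmC : C ≤ A ∧ C ≤ B := by grind
  rw [show A * B * C = C * A * B by ring]
  refine (mul_rpow_neg_le_of_le hC hd hp hpq hqp hmC.1 hmC.2
    (by linarith [hmC.1]) (by linarith [hmC.2])).trans ?_
  gcongr
  linarith

end RpowBounds

section PlaneIntegrals

lemma setLIntegral_ball_norm_rpow_neg_lt_top {e : ℝ} (he : e < 2) (r : ℝ) :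
    ∫⁻ x in Metric.ball (0 : ℂ) r, ENNReal.ofReal (‖x‖ ^ (-e)) < ⊤ := by
  refine IntegrableOn.setLIntegral_lt_top ?_
  refine integrableOn_ball_of_norm_le_rpow (C := 1) (α := e) (by simp) (by simpa using he)
    (Filter.Eventually.of_forall fun x => ?_)
    (by fun_prop : Measurable fun x : ℂ => ‖x‖ ^ (-e)).aestronglyMeasurable
  rw [one_mul, Real.norm_of_nonneg (by positivity)]

/-- The integrals of `‖x - r‖ ^ (-q)` over a fixed disc are bounded uniformly in the pole `r`. -/
lemma exists_setLIntegral_ball_norm_sub_rpow_neg_le {q : ℝ} (hq0 : 0 ≤ q) (hq : q < 2) (ρ : ℝ) :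
    ∃ M : ENNReal, M < ⊤ ∧ ∀ r : ℂ,
      ∫⁻ x in Metric.ball (0 : ℂ) ρ, ENNReal.ofReal (‖x - r‖ ^ (-q)) ≤ M := by
  set g : ℂ → ENNReal := (Metric.ball (0 : ℂ) 1).indicator
    fun x => ENNReal.ofReal (‖x‖ ^ (-q)) with hg
  refine ⟨volume (Metric.ball (0 : ℂ) ρ) + ∫⁻ x, g x, ?_, fun r => ?_⟩
  · rw [ENNReal.add_lt_top, hg, lintegral_indicator measurableSet_ball]
    exact ⟨measure_ball_lt_top, setLIntegral_ball_norm_rpow_neg_lt_top hq 1⟩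
  · calc ∫⁻ x in Metric.ball (0 : ℂ) ρ, ENNReal.ofReal (‖x - r‖ ^ (-q))
        ≤ ∫⁻ x in Metric.ball (0 : ℂ) ρ, (1 + g (x - r)) := by
          refine lintegral_mono fun x => ?_
          by_cases hx : x - r ∈ Metric.ball (0 : ℂ) 1
          · simp [hg, Set.indicator_of_mem hx]
          · rw [mem_ball_zero_iff, not_lt] at hx
            refine le_add_right ?_
            rw [ENNReal.ofReal_le_one]
            exact Real.rpow_le_one_of_one_le_of_nonpos hx (by linarith)
      _ = volume (Metric.ball (0 : ℂ) ρ) + ∫⁻ x in Metric.ball (0 : ℂ) ρ, g (x - r) := by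
          rw [lintegral_add_left measurable_const, setLIntegral_one]
      _ ≤ volume (Metric.ball (0 : ℂ) ρ) + ∫⁻ x, g (x - r) := by
          gcongr
          exact Measure.restrict_le_self
      _ = volume (Metric.ball (0 : ℂ) ρ) + ∫⁻ x, g x := by
          rw [lintegral_sub_right_eq_self]

end PlaneIntegrals

section Z12

/-- The branches of `x² + a x y² + y³ = 0` over a small `y` are separated from each other and from
`x = 0` at scale `‖y‖ ^ (3 / 2)`. -/
lemma exists_roots_Z12 {a y : ℂ} {w : ℝ} (hw : 0 ≤ w) (hy : ‖y‖ = w ^ 2) (haw : ‖a‖ * w ≤ 1)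
    (haw' : ‖a‖ ^ 2 * w ^ 2 ≤ 1) :
    ∃ r s : ℂ, (∀ x : ℂ, x ^ 2 + a * x * y ^ 2 + y ^ 3 = (x - r) * (x - s)) ∧
      w ^ 3 / 4 ≤ ‖r‖ ∧ w ^ 3 / 4 ≤ ‖s‖ ∧ w ^ 3 / 4 ≤ ‖r - s‖ := by
  obtain ⟨z, hz⟩ := IsAlgClosed.exists_pow_nat_eq (y ^ 3 * (a ^ 2 * y - 4)) (n := 2) (by norm_num)
  have hfour : 3 ≤ ‖a ^ 2 * y - 4‖ := by
    have h := norm_sub_norm_le (4 : ℂ) (a ^ 2 * y)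
    rw [norm_sub_rev, norm_mul, norm_pow, hy] at h
    norm_num at h
    linarith
  have hw3 : 0 ≤ w ^ 3 := by positivity
  have hz2 : (3 / 2 * w ^ 3) ^ 2 ≤ ‖z‖ ^ 2 := by
    rw [← norm_pow, hz, norm_mul, norm_pow, hy]
    nlinarith [sq_nonneg (w ^ 3)]
  have hznorm : 3 / 2 * w ^ 3 ≤ ‖z‖ := le_of_sq_le_sq hz2 (norm_nonneg z)
  have hb : ‖a * y ^ 2‖ ≤ w ^ 3 := by
    rw [norm_mul, norm_pow, hy]
    nlinarith
  refine ⟨(-(a * y ^ 2) + z) / 2, (-(a * y ^ 2) - z) / 2, fun x => ?_, ?_, ?_, ?_⟩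
  · linear_combination (1 / 4 : ℂ) * hz
  · have h := norm_sub_norm_le z (a * y ^ 2)
    rw [norm_div, show -(a * y ^ 2) + z = z - a * y ^ 2 by ring]
    norm_num
    linarith
  · have h := norm_sub_le (z + a * y ^ 2) (a * y ^ 2)
    rw [add_sub_cancel_right] at h
    rw [norm_div, show -(a * y ^ 2) - z = -(z + a * y ^ 2) by ring, norm_neg]
    norm_num
    linarith
  · rw [show (-(a * y ^ 2) + z) / 2 - (-(a * y ^ 2) - z) / 2 = z by ring]
    linarith

lemma exists_integrableOn_Z12 (a : ℂ) {c : ℝ} (hc : 2 / 5 < c) (hc' : c < 5 / 11) :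
    ∃ ε : ℝ, 0 < ε ∧ IntegrableOn
      (fun p : ℂ × ℂ => ‖p.1 ^ 3 * p.2 + p.1 * p.2 ^ 4 + a * p.1 ^ 2 * p.2 ^ 3‖ ^ (-2 * c))
      (Metric.ball (0 : ℂ × ℂ) ε) volume := by
  obtain ⟨p, rfl⟩ : ∃ p, c = p / 2 := ⟨2 * c, by ring⟩
  obtain ⟨q, hq, hqp⟩ : ∃ q, q < 2 ∧ 11 * p - 4 < 3 * q :=
    ⟨(2 + (11 * p - 4) / 3) / 2, by linarith, by linarith⟩
  obtain ⟨M, hM, hMr⟩ := exists_setLIntegral_ball_norm_sub_rpow_neg_le (q := q) (by linarith) hq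
    (1 / (1 + ‖a‖ ^ 2))
  have hε : 0 < 1 / (1 + ‖a‖ ^ 2) := by positivity
  set ε : ℝ := 1 / (1 + ‖a‖ ^ 2) with hε_def
  set F : ℂ × ℂ → ℝ := fun p' =>
    ‖p'.1 ^ 3 * p'.2 + p'.1 * p'.2 ^ 4 + a * p'.1 ^ 2 * p'.2 ^ 3‖ ^ (-2 * (p / 2)) with hF
  have hFm : Measurable F := by fun_prop
  refine ⟨ε, hε, hFm.aestronglyMeasurable, ?_⟩
  rw [hasFiniteIntegral_iff_ofReal (Filter.Eventually.of_forall fun _ => by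
    simp only [hF, Pi.zero_apply]; positivity)]
  set K : ℝ := (1 / 8) ^ (-(3 * p - q)) with hK
  have hinner : ∀ y ∈ Metric.ball (0 : ℂ) ε,
      ∫⁻ x in Metric.ball (0 : ℂ) ε, ENNReal.ofReal (F (x, y)) ≤
        ENNReal.ofReal (‖y‖ ^ (-((11 * p - 3 * q) / 2))) * (ENNReal.ofReal K * (M + M + M)) := by
    intro y hy
    rw [mem_ball_zero_iff] at hy
    rcases eq_or_ne y 0 with rfl | hy0
    · have h0 : ∀ x, F (x, 0) = 0 := fun x => by
        simp only [hF]
        norm_num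
        rw [Real.zero_rpow (by linarith)]
      simp [h0]
    have hypos : 0 < ‖y‖ := norm_pos_iff.2 hy0
    obtain ⟨w, hw, hyw⟩ : ∃ w : ℝ, 0 < w ∧ ‖y‖ = w ^ 2 :=
      ⟨√‖y‖, Real.sqrt_pos.2 hypos, (Real.sq_sqrt hypos.le).symm⟩
    have haw' : ‖a‖ ^ 2 * w ^ 2 ≤ 1 := by
      rw [hε_def, lt_div_iff₀ (by positivity), hyw] at hy
      nlinarith [sq_nonneg w]
    have haw : ‖a‖ * w ≤ 1 := by
      rw [← mul_pow] at haw'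
      exact (sq_le_one_iff₀ (by positivity)).1 haw'
    obtain ⟨r, s, hfac, hr, hs, hrs⟩ := exists_roots_Z12 hw.le hyw haw haw'
    have hpow : (‖y‖ ^ (-p)) * (w ^ 3 / 8) ^ (-(3 * p - q)) =
        ‖y‖ ^ (-((11 * p - 3 * q) / 2)) * K := by
      rw [div_eq_mul_one_div, Real.mul_rpow (by positivity) (by positivity), ← mul_assoc, hyw,
        ← Real.rpow_natCast w 3, ← Real.rpow_natCast w 2, ← Real.rpow_mul hw.le,
        ← Real.rpow_mul hw.le, ← Real.rpow_mul hw.le, ← Real.rpow_add hw]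
      congr 2
      push_cast
      ring
    have hpt : ∀ x : ℂ, F (x, y) ≤ ‖y‖ ^ (-((11 * p - 3 * q) / 2)) *
        (K * (‖x - 0‖ ^ (-q) + ‖x - r‖ ^ (-q) + ‖x - s‖ ^ (-q))) := by
      intro x
      have hf : x ^ 3 * y + x * y ^ 4 + a * x ^ 2 * y ^ 3 = y * ((x - 0) * (x - r) * (x - s)) := by
        rw [mul_assoc (x - 0), ← hfac x]
        ring
      simp only [hF]
      rw [hf, norm_mul, norm_mul, show -2 * (p / 2) = -p by ring,
        Real.mul_rpow (by positivity) (by positivity), ← mul_assoc, ← hpow,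
        mul_assoc (‖y‖ ^ (-p))]
      refine mul_le_mul_of_nonneg_left ?_ (by positivity)
      rw [norm_mul]
      refine mul_rpow_neg_le_add (norm_nonneg _) (norm_nonneg _) (norm_nonneg _) (by positivity)
        (by linarith) (by linarith) (by linarith) ?_ ?_ ?_
      · have h := norm_sub_le (x - 0) (x - r)
        rw [sub_sub_sub_cancel_left, sub_zero] at h
        linarith
      · have h := norm_sub_le (x - 0) (x - s)
        rw [sub_sub_sub_cancel_left, sub_zero] at h
        linarith
      · have h := norm_sub_le (x - r) (x - s)
        rw [sub_sub_sub_cancel_left, norm_sub_rev] at h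
        linarith
    have hm : ∀ r : ℂ, Measurable fun x : ℂ => ENNReal.ofReal (‖x - r‖ ^ (-q)) := fun r => by
      fun_prop
    calc ∫⁻ x in Metric.ball (0 : ℂ) ε, ENNReal.ofReal (F (x, y))
        ≤ ∫⁻ x in Metric.ball (0 : ℂ) ε, ENNReal.ofReal (‖y‖ ^ (-((11 * p - 3 * q) / 2))) *
            (ENNReal.ofReal K * (ENNReal.ofReal (‖x - 0‖ ^ (-q)) + ENNReal.ofReal (‖x - r‖ ^ (-q)) +
              ENNReal.ofReal (‖x - s‖ ^ (-q)))) := by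
          refine lintegral_mono fun x => ?_
          rw [← ENNReal.ofReal_add (by positivity) (by positivity),
            ← ENNReal.ofReal_add (by positivity) (by positivity),
            ← ENNReal.ofReal_mul (by positivity), ← ENNReal.ofReal_mul (by positivity)]
          exact ENNReal.ofReal_le_ofReal (hpt x)
      _ ≤ _ := by
          rw [lintegral_const_mul _ (by fun_prop), lintegral_const_mul _ (by fun_prop),
            lintegral_add_right _ (hm s), lintegral_add_right _ (hm r)]
          gcongr
          exacts [hMr 0, hMr r, hMr s]
  have hball : Metric.ball (0 : ℂ × ℂ) ε = Metric.ball (0 : ℂ) ε ×ˢ Metric.ball (0 : ℂ) ε := by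
    rw [ball_prod_same]
    rfl
  rw [hball, Measure.volume_eq_prod, ← Measure.prod_restrict,
    lintegral_prod_symm _ (by fun_prop)]
  refine (setLIntegral_mono' measurableSet_ball hinner).trans_lt ?_
  rw [lintegral_mul_const _ (by fun_prop)]
  exact ENNReal.mul_lt_top
    (setLIntegral_ball_norm_rpow_neg_lt_top (by linarith) ε)
    (ENNReal.mul_lt_top ENNReal.ofReal_lt_top (by simp [hM]))

/-- On the weighted polydisc of weights `(3, 2)` and radius `t`, away from the zero locus,
the `Z₁₂` polynomial has order `t ^ 11`. -/
lemma norm_Z12_bounds {a x y : ℂ} {t : ℝ} (ht : 0 < t) (hat : ‖a‖ * t ≤ 1)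
    (hx : t ^ 3 / 2 < ‖x‖) (hx' : ‖x‖ < t ^ 3) (hy : 0 < ‖y‖) (hy' : ‖y‖ < t ^ 2 / 4) :
    0 < ‖x ^ 3 * y + x * y ^ 4 + a * x ^ 2 * y ^ 3‖ ∧
      ‖x ^ 3 * y + x * y ^ 4 + a * x ^ 2 * y ^ 3‖ ≤ 3 * t ^ 11 := by
  have ht3 : 0 < t ^ 3 := by positivity
  have hxpos : 0 < ‖x‖ := by linarith
  have hx2 : (t ^ 3 / 2) ^ 2 < ‖x‖ ^ 2 := by gcongr
  have hx2' : ‖x‖ ^ 2 ≤ (t ^ 3) ^ 2 := by gcongr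
  have hy3 : ‖y‖ ^ 3 ≤ (t ^ 2 / 4) ^ 3 := by gcongr
  have hmix : ‖a‖ * ‖x‖ * ‖y‖ ^ 2 ≤ t ^ 6 / 16 := by
    calc ‖a‖ * ‖x‖ * ‖y‖ ^ 2 ≤ ‖a‖ * t ^ 3 * (t ^ 2 / 4) ^ 2 := by gcongr
      _ = (‖a‖ * t) * (t ^ 6 / 16) := by ring
      _ ≤ 1 * (t ^ 6 / 16) := by gcongr
      _ = t ^ 6 / 16 := one_mul _
  have ht6 : 0 < t ^ 6 := by positivity
  have hfac : x ^ 3 * y + x * y ^ 4 + a * x ^ 2 * y ^ 3 =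
      x * y * (x ^ 2 + (y ^ 3 + a * x * y ^ 2)) := by ring
  have htail : ‖y ^ 3 + a * x * y ^ 2‖ ≤ ‖y‖ ^ 3 + ‖a‖ * ‖x‖ * ‖y‖ ^ 2 := by
    refine (norm_add_le (y ^ 3) (a * x * y ^ 2)).trans_eq ?_
    rw [norm_mul, norm_mul, norm_pow, norm_pow]
  rw [hfac, norm_mul, norm_mul]
  constructor
  · have h := norm_sub_le (x ^ 2 + (y ^ 3 + a * x * y ^ 2)) (y ^ 3 + a * x * y ^ 2)
    rw [add_sub_cancel_right, norm_pow] at h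
    have : 0 < ‖x ^ 2 + (y ^ 3 + a * x * y ^ 2)‖ := by nlinarith
    positivity
  · have h := norm_add_le (x ^ 2) (y ^ 3 + a * x * y ^ 2)
    rw [norm_pow] at h
    have h3 : ‖x ^ 2 + (y ^ 3 + a * x * y ^ 2)‖ ≤ 3 * t ^ 6 := by nlinarith
    calc ‖x‖ * ‖y‖ * ‖x ^ 2 + (y ^ 3 + a * x * y ^ 2)‖ ≤ t ^ 3 * (t ^ 2 / 4) * (3 * t ^ 6) := by
          gcongr
      _ = 3 / 4 * t ^ 11 := by ring
      _ ≤ 3 * t ^ 11 := by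
          have : 0 < t ^ 11 := by positivity
          linarith

lemma le_of_integrableOn_Z12 {a : ℂ} {c ε : ℝ} (hε : 0 < ε)
    (hF_int : IntegrableOn
      (fun p : ℂ × ℂ => ‖p.1 ^ 3 * p.2 + p.1 * p.2 ^ 4 + a * p.1 ^ 2 * p.2 ^ 3‖ ^ (-2 * c))
      (Metric.ball (0 : ℂ × ℂ) ε) volume) : c ≤ 5 / 11 := by
  by_contra! hc
  set F : ℂ × ℂ → ℝ := fun p =>
    ‖p.1 ^ 3 * p.2 + p.1 * p.2 ^ 4 + a * p.1 ^ 2 * p.2 ^ 3‖ ^ (-2 * c) with hF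
  set I : ℝ := ∫ p in Metric.ball (0 : ℂ × ℂ) ε, F p with hI
  set L : ℝ := 3 ^ (-2 * c) * (Real.pi ^ 2 / 1024) with hL
  have hLpos : 0 < L := by positivity
  have hbound : ∀ t : ℝ, 0 < t → t ≤ 1 → t ≤ ε → ‖a‖ * t ≤ 1 →
      L * t ^ (10 - 22 * c) ≤ I := by
    intro t ht ht1 htε hat
    set S : Set (ℂ × ℂ) := Metric.ball ((3 / 4 * t ^ 3 : ℝ) : ℂ) (t ^ 3 / 4) ×ˢ
      Metric.ball ((t ^ 2 / 8 : ℝ) : ℂ) (t ^ 2 / 8) with hS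
    have hmem : ∀ p ∈ S, t ^ 3 / 2 < ‖p.1‖ ∧ ‖p.1‖ < t ^ 3 ∧ 0 < ‖p.2‖ ∧ ‖p.2‖ < t ^ 2 / 4 := by
      rintro ⟨x, y⟩ ⟨hx, hy⟩
      rw [mem_ball_iff_norm] at hx hy
      have hx1 := abs_le.1 (abs_norm_sub_norm_le x ((3 / 4 * t ^ 3 : ℝ) : ℂ))
      have hy1 := abs_le.1 (abs_norm_sub_norm_le y ((t ^ 2 / 8 : ℝ) : ℂ))
      rw [Complex.norm_of_nonneg (by positivity)] at hx1 hy1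
      exact ⟨by linarith [hx1.1], by linarith [hx1.2], by linarith [hy1.1], by linarith [hy1.2]⟩
    have hSm : MeasurableSet S := measurableSet_ball.prod measurableSet_ball
    have hSsub : S ⊆ Metric.ball (0 : ℂ × ℂ) ε := by
      intro p hp
      obtain ⟨-, h1, -, h2⟩ := hmem p hp
      rw [mem_ball_zero_iff, Prod.norm_def, max_lt_iff]
      have h3 : t ^ 3 ≤ t := pow_le_of_le_one ht.le ht1 (by norm_num)
      have h4 : t ^ 2 ≤ t := pow_le_of_le_one ht.le ht1 (by norm_num)
      exact ⟨by linarith, by nlinarith⟩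
    have hvol : (volume : Measure (ℂ × ℂ)) S =
        ENNReal.ofReal (Real.pi ^ 2 / 1024 * t ^ 10) := by
      rw [hS, Measure.volume_eq_prod, Measure.prod_prod, Complex.volume_ball, Complex.volume_ball,
        ← ENNReal.ofReal_pow (by positivity), ← ENNReal.ofReal_pow (by positivity),
        ← ENNReal.ofReal_coe_nnreal, NNReal.coe_real_pi, ← ENNReal.ofReal_mul (by positivity),
        ← ENNReal.ofReal_mul (by positivity), ← ENNReal.ofReal_mul (by positivity)]
      congr 1
      ring
    have hlow : ∀ p ∈ S, (3 * t ^ 11) ^ (-2 * c) ≤ F p := by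
      intro p hp
      obtain ⟨h1, h2, h3, h4⟩ := hmem p hp
      obtain ⟨hpos, hle⟩ := norm_Z12_bounds ht hat h1 h2 h3 h4
      exact Real.rpow_le_rpow_of_nonpos hpos hle (by linarith)
    have hge := setIntegral_ge_of_const_le_real hSm (by rw [hvol]; exact ENNReal.ofReal_ne_top)
      hlow (hF_int.mono_set hSsub)
    have hmono : ∫ p in S, F p ≤ I :=
      setIntegral_mono_set hF_int
        (Filter.Eventually.of_forall fun _ => by simp only [hF, Pi.zero_apply]; positivity)
        hSsub.eventuallyLE
    refine le_trans (le_of_eq ?_) (hge.trans hmono)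
    rw [Measure.real, hvol, ENNReal.toReal_ofReal (by positivity),
      Real.mul_rpow (by positivity) (by positivity), hL, ← Real.rpow_natCast t 11,
      ← Real.rpow_natCast t 10, ← Real.rpow_mul ht.le,
      show (10 - 22 * c : ℝ) = (11 : ℕ) * (-2 * c) + (10 : ℕ) by push_cast; ring,
      Real.rpow_add ht]
    ring
  have htend := (tendsto_rpow_neg_nhdsGT_zero (y := 10 - 22 * c) (by linarith)).const_mul_atTop
    hLpos
  have hev := htend.eventually (Filter.eventually_gt_atTop I)
  have hδ : 0 < min (min 1 ε) (1 / (1 + ‖a‖)) := by positivity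
  obtain ⟨t, hIt, ht, htδ⟩ := (hev.and (Ioc_mem_nhdsGT hδ)).exists
  simp only [le_min_iff] at htδ
  refine absurd (hbound t ht htδ.1.1 htδ.1.2 ?_) (not_le.2 hIt)
  have := htδ.2
  rw [le_div_iff₀ (by positivity)] at this
  nlinarith

end Z12

theorem lct_Z12 (a : ℂ) :
    lct₀ (fun p : ℂ × ℂ => p.1 ^ 3 * p.2 + p.1 * p.2 ^ 4 + a * p.1 ^ 2 * p.2 ^ 3) = 5 / 11 := by
  refine csSup_eq_of_forall_le_of_forall_lt_exists_gt ?_ ?_ ?_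
  · obtain ⟨ε, hε, h⟩ := exists_integrableOn_Z12 a (c := 9 / 20) (by norm_num) (by norm_num)
    exact ⟨9 / 20, by norm_num, ε, hε, h⟩
  · rintro c ⟨-, ε, hε, h⟩
    exact le_of_integrableOn_Z12 hε h
  · intro b hb
    obtain ⟨c, hc, hc'⟩ := exists_between (max_lt hb (by norm_num : (2 / 5 : ℝ) < 5 / 11))
    rw [max_lt_iff] at hc
    exact ⟨c, ⟨by linarith [hc.2], exists_integrableOn_Z12 a hc.2 hc'⟩, hc.1⟩
end

section
/- For every complex number a, the W₁₃ singularity f(x,y) = x⁴ + x y⁴ + a y⁶ satisfies lct₀(f) = 7/16. -/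
open MeasureTheory

/-- If `x` is at distance at least `d` from `0` and from every root of the quartic `f(·, y)`, then
`d * max (‖x‖ ^ 3) (‖y‖ ^ 4) / 16 ≤ ‖f x y‖`: either the derivative in `x` is large, or `f` is
comparable to `x ^ 4`. -/
theorem mul_max_le_norm_quartic (a x y : ℂ) (d : ℝ) (r₁ r₂ r₃ r₄ : ℂ) (hd : 0 ≤ d)
    (ha : ‖a‖ ^ 3 * ‖y‖ ^ 2 * (16 / 3) ^ 4 ≤ (2 / 3) ^ 3)
    (hr : x ^ 4 + x * y ^ 4 + a * y ^ 6 = (x - r₁) * (x - r₂) * (x - r₃) * (x - r₄))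
    (hr' : 4 * x ^ 3 + y ^ 4 = (x - r₂) * (x - r₃) * (x - r₄) + (x - r₁) * (x - r₃) * (x - r₄)
      + (x - r₁) * (x - r₂) * (x - r₄) + (x - r₁) * (x - r₂) * (x - r₃))
    (h₀ : d ≤ ‖x‖) (h₁ : d ≤ ‖x - r₁‖) (h₂ : d ≤ ‖x - r₂‖) (h₃ : d ≤ ‖x - r₃‖)
    (h₄ : d ≤ ‖x - r₄‖) :
    d * max (‖x‖ ^ 3) (‖y‖ ^ 4) / 16 ≤ ‖x ^ 4 + x * y ^ 4 + a * y ^ 6‖ := by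
  set M := max (‖x‖ ^ 3) (‖y‖ ^ 4) with hM
  have hM0 : 0 ≤ M := le_max_of_le_left (by positivity)
  by_cases h : M / 4 ≤ ‖4 * x ^ 3 + y ^ 4‖
  · have key : d * ‖4 * x ^ 3 + y ^ 4‖ ≤ 4 * ‖x ^ 4 + x * y ^ 4 + a * y ^ 6‖ := by
      rw [hr, hr']
      simp only [norm_mul]
      have htri : ‖(x - r₂) * (x - r₃) * (x - r₄) + (x - r₁) * (x - r₃) * (x - r₄)
          + (x - r₁) * (x - r₂) * (x - r₄) + (x - r₁) * (x - r₂) * (x - r₃)‖ ≤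
          ‖x - r₂‖ * ‖x - r₃‖ * ‖x - r₄‖ + ‖x - r₁‖ * ‖x - r₃‖ * ‖x - r₄‖
          + ‖x - r₁‖ * ‖x - r₂‖ * ‖x - r₄‖ + ‖x - r₁‖ * ‖x - r₂‖ * ‖x - r₃‖ := by
        simp only [← norm_mul]
        exact norm_add₄_le
      have e := mul_le_mul_of_nonneg_left htri hd
      have e₁ := mul_le_mul_of_nonneg_right h₁
        (show 0 ≤ ‖x - r₂‖ * ‖x - r₃‖ * ‖x - r₄‖ by positivity)
      have e₂ := mul_le_mul_of_nonneg_right h₂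
        (show 0 ≤ ‖x - r₁‖ * ‖x - r₃‖ * ‖x - r₄‖ by positivity)
      have e₃ := mul_le_mul_of_nonneg_right h₃
        (show 0 ≤ ‖x - r₁‖ * ‖x - r₂‖ * ‖x - r₄‖ by positivity)
      have e₄ := mul_le_mul_of_nonneg_right h₄
        (show 0 ≤ ‖x - r₁‖ * ‖x - r₂‖ * ‖x - r₃‖ by positivity)
      linarith
    have := mul_le_mul_of_nonneg_left h hd
    linarith
  · push Not at h
    have hy4 : ‖y‖ ^ 4 ≤ 4 * ‖x‖ ^ 3 + ‖4 * x ^ 3 + y ^ 4‖ := by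
      have := norm_sub_le (4 * x ^ 3 + y ^ 4) (4 * x ^ 3)
      rw [show 4 * x ^ 3 + y ^ 4 - 4 * x ^ 3 = y ^ 4 by ring] at this
      simp only [norm_mul, norm_pow, RCLike.norm_ofNat] at this
      linarith
    have hMx : M ≤ 16 / 3 * ‖x‖ ^ 3 := by
      rcases max_choice (‖x‖ ^ 3) (‖y‖ ^ 4) with h' | h'
      · have : 0 ≤ ‖x‖ ^ 3 := by positivity
        rw [hM, h']; linarith
      · rw [← hM] at h'; linarith
    have hyM : ‖y‖ ^ 4 ≤ M := le_max_right _ _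
    have h3 : 5 / 3 * ‖x‖ ^ 3 ≤ ‖x ^ 3 + y ^ 4‖ := by
      have := norm_sub_le (4 * x ^ 3 + y ^ 4) (x ^ 3 + y ^ 4)
      rw [show 4 * x ^ 3 + y ^ 4 - (x ^ 3 + y ^ 4) = 3 * x ^ 3 by ring] at this
      simp only [norm_mul, norm_pow, RCLike.norm_ofNat] at this
      linarith
    have h6 : ‖a‖ * ‖y‖ ^ 6 ≤ 2 / 3 * ‖x‖ ^ 4 := by
      refine le_of_pow_le_pow_left₀ (n := 3) (by norm_num) (by positivity) ?_
      calc (‖a‖ * ‖y‖ ^ 6) ^ 3 = ‖a‖ ^ 3 * ‖y‖ ^ 2 * (‖y‖ ^ 4) ^ 4 := by ring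
        _ ≤ ‖a‖ ^ 3 * ‖y‖ ^ 2 * (16 / 3 * ‖x‖ ^ 3) ^ 4 := by
          gcongr; exact hyM.trans hMx
        _ = ‖a‖ ^ 3 * ‖y‖ ^ 2 * (16 / 3) ^ 4 * (‖x‖ ^ 3) ^ 4 := by ring
        _ ≤ (2 / 3) ^ 3 * (‖x‖ ^ 3) ^ 4 := by gcongr
        _ = (2 / 3 * ‖x‖ ^ 4) ^ 3 := by ring
    have hf : ‖x‖ ^ 4 ≤ ‖x ^ 4 + x * y ^ 4 + a * y ^ 6‖ := by
      have := norm_sub_le (x ^ 4 + x * y ^ 4 + a * y ^ 6) (a * y ^ 6)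
      rw [show x ^ 4 + x * y ^ 4 + a * y ^ 6 - a * y ^ 6 = x * (x ^ 3 + y ^ 4) by ring] at this
      simp only [norm_mul, norm_pow] at this
      have e := mul_le_mul_of_nonneg_left h3 (norm_nonneg x)
      nlinarith
    calc d * M / 16 ≤ ‖x‖ * (16 / 3 * ‖x‖ ^ 3) / 16 := by gcongr
      _ ≤ ‖x‖ ^ 4 := by nlinarith [show 0 ≤ ‖x‖ ^ 4 by positivity]
      _ ≤ _ := hf

open Polynomial in
theorem exists_quartic_roots (b c : ℂ) : ∃ r₁ r₂ r₃ r₄ : ℂ, ∀ x : ℂ,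
    x ^ 4 + x * b + c = (x - r₁) * (x - r₂) * (x - r₃) * (x - r₄) ∧
    4 * x ^ 3 + b = (x - r₂) * (x - r₃) * (x - r₄) + (x - r₁) * (x - r₃) * (x - r₄)
      + (x - r₁) * (x - r₂) * (x - r₄) + (x - r₁) * (x - r₂) * (x - r₃) := by
  set P : ℂ[X] := X ^ 4 + X * C b + C c with hP
  have hdeg : P.natDegree = 4 := by rw [hP]; compute_degree!
  have hmon : P.Monic := by rw [hP]; monicity!
  have hs : P.Splits := IsAlgClosed.splits P
  have hprod := hs.eq_prod_roots_of_monic hmon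
  have hcard := hs.natDegree_eq_card_roots
  rw [hdeg] at hcard
  obtain ⟨l, hl⟩ := Quot.exists_rep P.roots
  change (l : Multiset ℂ) = P.roots at hl
  rw [← hl, Multiset.coe_card] at hcard
  match l, hcard with
  | [r₁, r₂, r₃, r₄], _ =>
    rw [← hl] at hprod
    refine ⟨r₁, r₂, r₃, r₄, fun x => ⟨?_, ?_⟩⟩
    · have := congrArg (eval x) hprod
      simp [hP] at this
      linear_combination this
    · have := congrArg (fun Q => eval x (derivative Q)) hprod
      simp [hP, derivative_mul] at this
      linear_combination this

theorem setLIntegral_ball_enorm_sub_rpow_lt_top {γ : ℝ} (hγ₀ : 0 < γ) (hγ : γ < 2) :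
    ∃ K : ENNReal, K < ⊤ ∧ ∀ s : ℂ, ∫⁻ x in Metric.ball (0 : ℂ) 1, ‖x - s‖ₑ ^ (-γ) ≤ K := by
  have h0 : ∫⁻ x in Metric.ball (0 : ℂ) 1, ‖x‖ₑ ^ (-γ) < ⊤ := by
    have hi : IntegrableOn (fun x : ℂ => ‖x‖ ^ (-γ)) (Metric.ball 0 1) := by
      refine (integrableOn_fun_norm_addHaar volume (f := fun t : ℝ => t ^ (-γ))).2 ?_
      have h := (intervalIntegral.integrableOn_Ioo_rpow_iff (s := 1 - γ) zero_lt_one).2 (by linarith)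
      refine h.congr_fun (fun t ht => ?_) measurableSet_Ioo
      simp only [Complex.finrank_real_complex, smul_eq_mul]
      rw [sub_eq_add_neg, Real.rpow_add ht.1]
      simp
    refine lt_of_eq_of_lt (lintegral_congr_ae ?_) hi.2
    filter_upwards [ae_restrict_of_ae (Measure.ae_ne volume (0 : ℂ))] with x hx
    have : 0 < ‖x‖ := norm_pos_iff.2 hx
    rw [Real.enorm_of_nonneg (by positivity), ← ENNReal.ofReal_rpow_of_pos this, ofReal_norm]
  refine ⟨(∫⁻ x in Metric.ball (0 : ℂ) 1, ‖x‖ₑ ^ (-γ)) + volume (Metric.ball (0 : ℂ) 1),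
    ENNReal.add_lt_top.2 ⟨h0, measure_ball_lt_top⟩, fun s => ?_⟩
  calc ∫⁻ x in Metric.ball (0 : ℂ) 1, ‖x - s‖ₑ ^ (-γ)
      ≤ ∫⁻ x in Metric.ball (0 : ℂ) 1,
          ((Metric.ball (0 : ℂ) 1).indicator (fun z => ‖z‖ₑ ^ (-γ)) (x - s) + 1) := by
        refine lintegral_mono fun x => ?_
        by_cases hx : x - s ∈ Metric.ball (0 : ℂ) 1
        · simp [hx]
        · rw [Set.indicator_of_notMem hx, zero_add]
          have : 1 ≤ ‖x - s‖ₑ := by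
            rw [mem_ball_zero_iff, not_lt] at hx
            rw [← ofReal_norm]; exact ENNReal.one_le_ofReal.2 hx
          exact ENNReal.rpow_le_one_of_one_le_of_neg this (by linarith)
    _ = (∫⁻ x in Metric.ball (0 : ℂ) 1,
          (Metric.ball (0 : ℂ) 1).indicator (fun z => ‖z‖ₑ ^ (-γ)) (x - s))
          + volume (Metric.ball (0 : ℂ) 1) := by
        rw [lintegral_add_right _ measurable_const]; simp
    _ ≤ _ := by
        refine add_le_add_left ?_ _
        refine (setLIntegral_le_lintegral _ _).trans ?_
        rw [lintegral_sub_right_eq_self (fun z => (Metric.ball (0 : ℂ) 1).indicator _ z) s,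
          lintegral_indicator measurableSet_ball]
theorem rpow_neg_le_of_mul_max_le {X Y d N p : ℝ} (hd : 0 < d) (hY : 0 < Y) (hdX : d ≤ X)
    (hp : 0 < p) (h : d * max (X ^ 3) (Y ^ 4) / 16 ≤ N) :
    N ^ (-(7 * p)) ≤ 16 ^ (7 * p) * (Y ^ (-(16 * p)) * d ^ (-(16 * p))) := by
  set M := max (X ^ 3) (Y ^ 4)
  have hYM : Y ^ 4 ≤ M := le_max_right _ _
  have hdM : d ^ 3 ≤ M := (pow_le_pow_left₀ hd.le hdX 3).trans (le_max_left _ _)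
  have hM : 0 < M := lt_of_lt_of_le (by positivity) hYM
  have hN : 0 < N := lt_of_lt_of_le (by positivity) h
  have key : (Y * d) ^ 16 ≤ (16 * N) ^ 7 := calc
    (Y * d) ^ 16 = d ^ 7 * ((d ^ 3) ^ 3 * (Y ^ 4) ^ 4) := by ring
    _ ≤ d ^ 7 * (M ^ 3 * M ^ 4) := by gcongr
    _ = (d * M) ^ 7 := by ring
    _ ≤ (16 * N) ^ 7 := pow_le_pow_left₀ (by positivity) (by linarith) 7
  have := Real.rpow_le_rpow_of_nonpos (by positivity) key (neg_nonpos.2 hp.le)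
  rw [← Real.rpow_natCast, ← Real.rpow_natCast, ← Real.rpow_mul (by positivity),
    ← Real.rpow_mul (by positivity), Real.mul_rpow (by positivity) (by positivity),
    Real.mul_rpow (by positivity) (by positivity)] at this
  push_cast at this
  rw [mul_neg, mul_neg, Real.rpow_neg (x := 16) (by norm_num)] at this
  rwa [← inv_mul_le_iff₀ (by positivity)]

theorem exists_finset_enorm_rpow_le (a y : ℂ) {p : ℝ} (hp : 0 < p) (hy : y ≠ 0)
    (ha : ‖a‖ ^ 3 * ‖y‖ ^ 2 * (16 / 3) ^ 4 ≤ (2 / 3) ^ 3) :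
    ∃ S : Finset ℂ, S.card ≤ 5 ∧ ∀ x : ℂ,
      ‖‖x ^ 4 + x * y ^ 4 + a * y ^ 6‖ ^ (-(7 * p))‖ₑ ≤
        ENNReal.ofReal (16 ^ (7 * p)) * (‖y‖ₑ ^ (-(16 * p)) *
          ∑ s ∈ S, ‖x - s‖ₑ ^ (-(16 * p))) := by
  obtain ⟨r₁, r₂, r₃, r₄, hr⟩ := exists_quartic_roots (y ^ 4) (a * y ^ 6)
  refine ⟨{0, r₁, r₂, r₃, r₄}, Finset.card_le_five, fun x => ?_⟩
  obtain ⟨s, hs, hmin⟩ := Finset.exists_min_image {0, r₁, r₂, r₃, r₄} (fun s => ‖x - s‖)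
    (Finset.insert_nonempty _ _)
  simp only [Finset.mem_insert, Finset.mem_singleton, forall_eq_or_imp, forall_eq, sub_zero]
    at hmin
  obtain ⟨h₀, h₁, h₂, h₃, h₄⟩ := hmin
  have hb := mul_max_le_norm_quartic a x y ‖x - s‖ r₁ r₂ r₃ r₄ (norm_nonneg _) ha (hr x).1 (hr x).2
    h₀ h₁ h₂ h₃ h₄
  have hy' : 0 < ‖y‖ := norm_pos_iff.2 hy
  calc _ ≤ ENNReal.ofReal (16 ^ (7 * p)) * (‖y‖ₑ ^ (-(16 * p)) * ‖x - s‖ₑ ^ (-(16 * p))) := by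
        rcases eq_or_ne x s with rfl | hxs
        · rw [sub_self, enorm_zero, ENNReal.zero_rpow_of_neg (by linarith), ENNReal.mul_top,
            ENNReal.mul_top]
          · exact le_top
          · simp; positivity
          · rw [← ofReal_norm, ENNReal.ofReal_rpow_of_pos hy']
            simp; positivity
        · have hd : 0 < ‖x - s‖ := norm_pos_iff.2 (sub_ne_zero.2 hxs)
          rw [← ofReal_norm y, ← ofReal_norm (x - s), ENNReal.ofReal_rpow_of_pos hy',
            ENNReal.ofReal_rpow_of_pos hd, ← ENNReal.ofReal_mul (by positivity),
            ← ENNReal.ofReal_mul (by positivity), Real.enorm_of_nonneg (by positivity)]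
          exact ENNReal.ofReal_le_ofReal (rpow_neg_le_of_mul_max_le hd hy' h₀ hp hb)
    _ ≤ _ := by
        gcongr
        exact Finset.single_le_sum (f := fun s => ‖x - s‖ₑ ^ (-(16 * p)))
          (fun _ _ => zero_le) hs

/-- Integrability of `‖f‖ ^ (-2 * c)` near the origin for `c = 7 / 2 * p < 7 / 16`. -/
theorem exists_integrableOn_ball (a : ℂ) {p : ℝ} (hp : 0 < p) (hp' : 16 * p < 2) :
    ∃ ε : ℝ, 0 < ε ∧ IntegrableOn (fun q : ℂ × ℂ =>
      ‖q.1 ^ 4 + q.1 * q.2 ^ 4 + a * q.2 ^ 6‖ ^ (-(7 * p))) (Metric.ball 0 ε) volume := by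
  obtain ⟨K, hK, hKs⟩ := setLIntegral_ball_enorm_sub_rpow_lt_top (by positivity) hp'
  obtain ⟨ε, hε, hε1, hεa⟩ : ∃ ε : ℝ, 0 < ε ∧ ε ≤ 1 ∧
      ‖a‖ ^ 3 * ε ^ 2 * (16 / 3) ^ 4 ≤ (2 / 3) ^ 3 := by
    have hc : ContinuousAt (fun ε : ℝ => ‖a‖ ^ 3 * ε ^ 2 * (16 / 3) ^ 4) 0 := by fun_prop
    have h1 : ∀ᶠ ε : ℝ in nhdsWithin 0 (Set.Ioi 0),
        ‖a‖ ^ 3 * ε ^ 2 * (16 / 3) ^ 4 ≤ (2 / 3) ^ 3 :=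
      (hc.eventually_le_const (by norm_num)).filter_mono nhdsWithin_le_nhds
    have h2 : ∀ᶠ ε : ℝ in nhdsWithin 0 (Set.Ioi 0), ε ≤ 1 :=
      (eventually_le_nhds zero_lt_one).filter_mono nhdsWithin_le_nhds
    obtain ⟨ε, ha, h1, h0⟩ := (h1.and (h2.and self_mem_nhdsWithin)).exists
    exact ⟨ε, h0, h1, ha⟩
  refine ⟨ε, hε, Measurable.aestronglyMeasurable (by fun_prop), ?_⟩
  rw [show (0 : ℂ × ℂ) = (0, 0) from rfl, ← ball_prod_same, hasFiniteIntegral_iff_enorm,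
    Measure.volume_eq_prod, ← Measure.prod_restrict, lintegral_prod_symm _ (by fun_prop)]
  have hsub : Metric.ball (0 : ℂ) ε ⊆ Metric.ball 0 1 := Metric.ball_subset_ball hε1
  set A := ENNReal.ofReal (16 ^ (7 * p))
  calc _ ≤ ∫⁻ y in Metric.ball (0 : ℂ) ε, A * (5 * K) * ‖y‖ₑ ^ (-(16 * p)) := by
        refine lintegral_mono_ae ?_
        filter_upwards [ae_restrict_of_ae (Measure.ae_ne volume (0 : ℂ)),
          ae_restrict_mem measurableSet_ball] with y hy hyb
        obtain ⟨S, hS, hbd⟩ := exists_finset_enorm_rpow_le a y hp hy (by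
          refine le_trans ?_ hεa
          have := (mem_ball_zero_iff.1 hyb).le
          gcongr)
        calc _ ≤ ∫⁻ x in Metric.ball (0 : ℂ) 1, A * (‖y‖ₑ ^ (-(16 * p)) *
                  ∑ s ∈ S, ‖x - s‖ₑ ^ (-(16 * p))) :=
              (lintegral_mono_set hsub).trans (lintegral_mono fun x => hbd x)
          _ = A * (‖y‖ₑ ^ (-(16 * p)) *
                ∑ s ∈ S, ∫⁻ x in Metric.ball (0 : ℂ) 1, ‖x - s‖ₑ ^ (-(16 * p))) := by
              rw [lintegral_const_mul _ (by fun_prop), lintegral_const_mul _ (by fun_prop),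
                lintegral_finsetSum _ (by fun_prop)]
          _ ≤ A * (‖y‖ₑ ^ (-(16 * p)) * (5 * K)) := by
              gcongr
              refine (Finset.sum_le_card_nsmul _ _ K fun s _ => hKs s).trans ?_
              rw [nsmul_eq_mul]
              gcongr
              exact_mod_cast hS
          _ = _ := by ring
    _ = A * (5 * K) * ∫⁻ y in Metric.ball (0 : ℂ) ε, ‖y‖ₑ ^ (-(16 * p)) :=
        lintegral_const_mul _ (by fun_prop)
    _ < ⊤ := by
        refine ENNReal.mul_lt_top (ENNReal.mul_lt_top ENNReal.ofReal_lt_top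
          (ENNReal.mul_lt_top (by simp) hK)) ?_
        refine ((lintegral_mono_set hsub).trans ?_).trans_lt hK
        simpa using hKs 0
theorem quartic_norm_bounds {a x y : ℂ} {δ t : ℝ} (hδ : δ = 1 / (2 * (1 + ‖a‖)))
    (ht : 0 < t) (ht1 : t ≤ 1) (hx : x ∈ Metric.ball (2 * (t : ℂ) ^ 4) (t ^ 4))
    (hy : y ∈ Metric.ball (0 : ℂ) (δ * t ^ 3)) :
    ‖x‖ ≤ 3 * t ^ 4 ∧ 0 < ‖x ^ 4 + x * y ^ 4 + a * y ^ 6‖ ∧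
      ‖x ^ 4 + x * y ^ 4 + a * y ^ 6‖ ≤ 82 * t ^ 16 := by
  have hδ0 : 0 < δ := by rw [hδ]; positivity
  have hδ2 : δ ≤ 1 / 2 := by
    rw [hδ]; gcongr; linarith [norm_nonneg a]
  have haδ : ‖a‖ * δ ≤ 1 / 2 := by
    rw [hδ, mul_one_div, div_le_div_iff₀ (by positivity) (by norm_num)]; linarith
  rw [mem_ball_zero_iff] at hy
  rw [mem_ball_iff_norm] at hx
  have hn : ‖2 * (t : ℂ) ^ 4‖ = 2 * t ^ 4 := by
    rw [norm_mul, norm_pow, Complex.norm_of_nonneg ht.le]; simp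
  have hx3 : ‖x‖ ≤ 3 * t ^ 4 := by
    have := norm_add_le (x - 2 * (t : ℂ) ^ 4) (2 * (t : ℂ) ^ 4)
    rw [sub_add_cancel] at this; linarith
  have hx1 : t ^ 4 ≤ ‖x‖ := by
    have := norm_sub_norm_le (2 * (t : ℂ) ^ 4) x
    rw [norm_sub_rev] at this; linarith
  have e₁ : ‖x * y ^ 4‖ ≤ 3 / 16 * t ^ 16 := by
    rw [norm_mul, norm_pow]
    calc ‖x‖ * ‖y‖ ^ 4 ≤ 3 * t ^ 4 * (1 / 2 * t ^ 3) ^ 4 := by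
          gcongr; exact hy.le.trans (by gcongr)
      _ = 3 / 16 * t ^ 16 := by ring
  have e₂ : ‖a * y ^ 6‖ ≤ 1 / 64 * t ^ 16 := by
    rw [norm_mul, norm_pow]
    calc ‖a‖ * ‖y‖ ^ 6 ≤ ‖a‖ * (δ * t ^ 3) ^ 6 := by gcongr
      _ = ‖a‖ * δ * δ ^ 5 * t ^ 16 * t ^ 2 := by ring
      _ ≤ 1 / 2 * (1 / 2) ^ 5 * t ^ 16 * 1 ^ 2 := by gcongr
      _ = 1 / 64 * t ^ 16 := by ring
  have e₃ : ‖x ^ 4‖ ≤ 81 * t ^ 16 := by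
    rw [norm_pow]
    calc ‖x‖ ^ 4 ≤ (3 * t ^ 4) ^ 4 := by gcongr
      _ = 81 * t ^ 16 := by ring
  have e₄ : t ^ 16 ≤ ‖x ^ 4‖ := by
    rw [norm_pow]
    calc t ^ 16 = (t ^ 4) ^ 4 := by ring
      _ ≤ ‖x‖ ^ 4 := by gcongr
  have ht16 : 0 < t ^ 16 := by positivity
  have hup := norm_add₃_le (a := x ^ 4) (b := x * y ^ 4) (c := a * y ^ 6)
  have hlow := norm_sub_le (x ^ 4 + x * y ^ 4 + a * y ^ 6) (x * y ^ 4 + a * y ^ 6)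
  rw [show x ^ 4 + x * y ^ 4 + a * y ^ 6 - (x * y ^ 4 + a * y ^ 6) = x ^ 4 by ring] at hlow
  have := norm_add_le (x * y ^ 4) (a * y ^ 6)
  exact ⟨hx3, by linarith, by linarith⟩

/-- For `c > 7 / 16` the integral over a box of size `t ^ 4` by `t ^ 3` grows like
`t ^ (14 - 32 * c)`. -/
theorem not_integrableOn_ball (a : ℂ) {c : ℝ} (hc : 7 / 16 < c) {ε : ℝ} (hε : 0 < ε) :
    ¬ IntegrableOn (fun q : ℂ × ℂ =>
      ‖q.1 ^ 4 + q.1 * q.2 ^ 4 + a * q.2 ^ 6‖ ^ (-2 * c)) (Metric.ball 0 ε) volume := by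
  intro hint
  set I := ∫ q in Metric.ball (0 : ℂ × ℂ) ε,
      ‖q.1 ^ 4 + q.1 * q.2 ^ 4 + a * q.2 ^ 6‖ ^ (-2 * c)
  obtain ⟨δ, hδ⟩ : ∃ δ : ℝ, δ = 1 / (2 * (1 + ‖a‖)) := ⟨_, rfl⟩
  have hδ0 : 0 < δ := by rw [hδ]; positivity
  have hδ1 : δ ≤ 1 := by
    rw [hδ, div_le_one (by positivity)]; linarith [norm_nonneg a]
  have key : ∀ t : ℝ, 0 < t → t ≤ 1 → 4 * t ≤ ε →
      82 ^ (-2 * c) * (Real.pi ^ 2 * δ ^ 2) ≤ I * t ^ (32 * c - 14) := by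
    intro t ht ht1 htε
    set B : Set (ℂ × ℂ) :=
      Metric.ball (2 * (t : ℂ) ^ 4) (t ^ 4) ×ˢ Metric.ball (0 : ℂ) (δ * t ^ 3) with hB
    have hsub : B ⊆ Metric.ball 0 ε := by
      rintro ⟨x, y⟩ ⟨hx, hy⟩
      have h3 := (quartic_norm_bounds hδ ht ht1 hx hy).1
      have hy' := mem_ball_zero_iff.1 hy
      have h4 : t ^ 4 ≤ t := pow_le_of_le_one ht.le ht1 (by norm_num)
      have h5 : δ * t ^ 3 ≤ 1 * t :=
        mul_le_mul hδ1 (pow_le_of_le_one ht.le ht1 (by norm_num)) (by positivity) zero_le_one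
      rw [mem_ball_zero_iff, Prod.norm_mk, max_lt_iff]
      constructor <;> dsimp only at * <;> linarith
    have hvol : volume B = ENNReal.ofReal (Real.pi ^ 2 * δ ^ 2 * t ^ 14) := by
      rw [hB, Measure.volume_eq_prod, Measure.prod_prod, Complex.volume_ball,
        Complex.volume_ball, ← ENNReal.ofReal_coe_nnreal, NNReal.coe_real_pi,
        ← ENNReal.ofReal_pow (by positivity), ← ENNReal.ofReal_pow (by positivity),
        ← ENNReal.ofReal_mul (by positivity), ← ENNReal.ofReal_mul (by positivity),
        ← ENNReal.ofReal_mul (by positivity)]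
      congr 1; ring
    have hle := setIntegral_ge_of_const_le_real (μ := volume) (s := B)
      (c := (82 * t ^ 16) ^ (-2 * c)) (measurableSet_ball.prod measurableSet_ball)
      (by rw [hvol]; exact ENNReal.ofReal_ne_top)
      (fun q hq => by
        obtain ⟨-, h1, h2⟩ := quartic_norm_bounds hδ ht ht1 hq.1 hq.2
        exact Real.rpow_le_rpow_of_nonpos h1 h2 (by linarith)) (hint.mono_set hsub)
    have hI := setIntegral_mono_set hint (ae_of_all _ fun q => by positivity) hsub.eventuallyLE
    have hle' := hle.trans hI
    rw [Measure.real, hvol, ENNReal.toReal_ofReal (by positivity),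
      Real.mul_rpow (by norm_num) (by positivity), ← Real.rpow_natCast t 16,
      ← Real.rpow_mul ht.le] at hle'
    have ht2 : t ^ (((16 : ℕ) : ℝ) * (-2 * c)) * (t ^ 14 * t ^ (32 * c - 14)) = 1 := by
      rw [← Real.rpow_natCast t 14, ← Real.rpow_add ht, ← Real.rpow_add ht,
        ← Real.rpow_zero t]
      congr 1; push_cast; ring
    have := mul_le_mul_of_nonneg_right hle' (show 0 ≤ t ^ (32 * c - 14) by positivity)
    refine le_trans (le_of_eq ?_) this
    linear_combination (-(82 ^ (-2 * c) * (Real.pi ^ 2 * δ ^ 2))) * ht2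
  have hlim : Filter.Tendsto (fun t : ℝ => I * t ^ (32 * c - 14))
      (nhdsWithin 0 (Set.Ioi 0)) (nhds 0) := by
    have hcont : ContinuousAt (fun t : ℝ => I * t ^ (32 * c - 14)) 0 :=
      continuousAt_const.mul (Real.continuousAt_rpow_const _ _ (Or.inr (by linarith)))
    have := hcont.tendsto.mono_left (nhdsWithin_le_nhds (s := Set.Ioi 0))
    rwa [Real.zero_rpow (by linarith), mul_zero] at this
  have hpos : 0 < (82 : ℝ) ^ (-2 * c) * (Real.pi ^ 2 * δ ^ 2) := by positivity
  refine absurd (ge_of_tendsto hlim ?_) hpos.not_ge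
  filter_upwards [self_mem_nhdsWithin, nhdsWithin_le_nhds (eventually_le_nhds zero_lt_one),
    nhdsWithin_le_nhds (eventually_le_nhds (show 0 < ε / 4 by positivity))] with t h0 h1 h2
  exact key t h0 h1 (by linarith)

theorem lct_W13 (a : ℂ) :
    lct₀ (fun p : ℂ × ℂ => p.1 ^ 4 + p.1 * p.2 ^ 4 + a * p.2 ^ 6) = 7 / 16 := by
  have hmem : ∀ p : ℝ, 0 < p → 16 * p < 2 → 7 / 2 * p ∈ { c : ℝ | 0 ≤ c ∧ ∃ ε : ℝ, 0 < ε ∧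
      IntegrableOn (fun q : ℂ × ℂ => ‖q.1 ^ 4 + q.1 * q.2 ^ 4 + a * q.2 ^ 6‖ ^ (-2 * c))
        (Metric.ball (0 : ℂ × ℂ) ε) volume } := by
    intro p hp hp'
    refine ⟨by positivity, ?_⟩
    rw [show -2 * (7 / 2 * p) = -(7 * p) by ring]
    exact exists_integrableOn_ball a hp hp'
  refine csSup_eq_of_forall_le_of_forall_lt_exists_gt ⟨_, hmem (1 / 16) (by norm_num) (by norm_num)⟩
    ?_ ?_
  · rintro c ⟨-, ε, hε, hint⟩
    by_contra! hc
    exact not_integrableOn_ball a hc hε hint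
  · intro w hw
    obtain ⟨p, hwp, hp⟩ := exists_between (show max 0 (2 / 7 * w) < 1 / 8 by
      rw [max_lt_iff]; constructor <;> linarith)
    rw [max_lt_iff] at hwp
    exact ⟨7 / 2 * p, hmem p hwp.1 (by linarith), by linarith⟩
end
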